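/- Let I be a fractional ideal of O_K with rescaled basis matrix g_I, and let ε₁, ε₂ be totally positive units of O_K whose logarithm vectors ℓ(εᵢ) = (log σ₁(εᵢ), log σ₂(εᵢ), log σ₃(εᵢ)) are linearly independent over ℝ; define â(s₁,s₂) = diag(σ₁(ε₁)^{s₁}σ₁(ε₂)^{s₂}, σ₂(ε₁)^{s₁}σ₂(ε₂)^{s₂}, σ₃(ε₁)^{s₁}σ₃(ε₂)^{s₂}) ∈ SL(3,ℝ). Then for every bounded continuous f : 𝕋² × (Γ\G) → ℝ, lim_{T→∞} ∫_{[0,1]²} f((s₁,s₂), Γ·g_I·â(s₁,s₂)·g₀^{−1}·a(−T)) ds₁ds₂ = ∫_{[0,1]²} ∫_{Γ\G} f(s, g) dμ(g) ds; that is, the translates by g₀^{−1}a(−T) of the compact piece {Γ g_I â(s) : s ∈ [0,1]²} of the closed A-orbit through Γg_I equidistribute in Γ\G. -/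

import Mathlib

open Matrix MeasureTheory Filter Topology Polynomial NumberField

noncomputable section

/-- `G = SL(3, ℝ)`. -/
abbrev SL3R := Matrix.SpecialLinearGroup (Fin 3) ℝ

instance : TopologicalSpace SL3R :=
  show TopologicalSpace {A : Matrix (Fin 3) (Fin 3) ℝ // A.det = 1} from inferInstance

/-- `Γ = SL(3, ℤ)`, viewed as a subgroup of `SL(3, ℝ)`. -/
def Gamma3 : Subgroup SL3R :=
  (Matrix.SpecialLinearGroup.map (n := Fin 3) (Int.castRingHom ℝ)).range

/-- The homogeneous space `Γ \ G`, i.e. the set of right cosets `Γ g`. -/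
def X3 := Quotient (QuotientGroup.rightRel Gamma3)

instance : TopologicalSpace X3 := instTopologicalSpaceQuotient

instance : MeasurableSpace X3 := borel X3

/-- The projection `G → Γ \ G`, `g ↦ Γ g`. -/
def proj3 : SL3R → X3 := Quotient.mk''

/-- The right action of `G` on `Γ \ G`: `Γ x ↦ Γ x g`. -/
def rmul3 (g : SL3R) : X3 → X3 :=
  Quotient.map' (· * g) (fun a b h => by
    rw [QuotientGroup.rightRel_apply] at h ⊢
    simpa [_root_.mul_inv_rev, ← mul_assoc] using h)

/-- The diagonal matrices `a(t) = diag(e^{-2t}, e^t, e^t)`. -/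
def amat (t : ℝ) : SL3R :=
  ⟨Matrix.diagonal ![Real.exp (-2 * t), Real.exp t, Real.exp t], by
    rw [Matrix.det_diagonal, Fin.prod_univ_three]
    simp only [Matrix.cons_val_zero, Matrix.cons_val_one, Matrix.head_cons,
      Matrix.cons_val_two, Matrix.tail_cons, ← Real.exp_add]
    norm_num
    ring⟩

section

instance SL3R.topGroup : IsTopologicalGroup SL3R :=
  Matrix.SpecialLinearGroup.topologicalGroup

lemma SL3R.isClosedEmbedding_coe :
    IsClosedEmbedding (fun g : SL3R => (g : Matrix (Fin 3) (Fin 3) ℝ)) := by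
  have h : IsClosed {A : Matrix (Fin 3) (Fin 3) ℝ | A.det = 1} :=
    isClosed_eq (continuous_id.matrix_det) continuous_const
  exact h.isClosedEmbedding_subtypeVal

lemma SL3R.continuous_coe : Continuous (fun g : SL3R => (g : Matrix (Fin 3) (Fin 3) ℝ)) :=
  SL3R.isClosedEmbedding_coe.continuous

lemma SL3R.continuous_iff {Y : Type*} [TopologicalSpace Y] {f : Y → SL3R} :
    Continuous f ↔ Continuous (fun y => (f y : Matrix (Fin 3) (Fin 3) ℝ)) :=
  SL3R.isClosedEmbedding_coe.isInducing.continuous_iff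

lemma SL3R.tendsto_iff {ι : Type*} {l : Filter ι} {f : ι → SL3R} {g : SL3R} :
    Tendsto f l (𝓝 g) ↔ Tendsto (fun y => (f y : Matrix (Fin 3) (Fin 3) ℝ)) l (𝓝 g.1) :=
  SL3R.isClosedEmbedding_coe.isInducing.tendsto_nhds_iff

instance SL3R.t2 : T2Space SL3R := SL3R.isClosedEmbedding_coe.isEmbedding.t2Space
instance SL3R.sc : SecondCountableTopology SL3R :=
  haveI : SecondCountableTopology (Matrix (Fin 3) (Fin 3) ℝ) :=
    inferInstanceAs (SecondCountableTopology (Fin 3 → Fin 3 → ℝ))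
  SL3R.isClosedEmbedding_coe.isEmbedding.secondCountableTopology
instance SL3R.lcs : LocallyCompactSpace SL3R :=
  haveI : LocallyCompactSpace (Matrix (Fin 3) (Fin 3) ℝ) :=
    inferInstanceAs (LocallyCompactSpace (Fin 3 → Fin 3 → ℝ))
  SL3R.isClosedEmbedding_coe.locallyCompactSpace

lemma Gamma3_isClosed : IsClosed (Gamma3 : Set SL3R) := by
  have h : (Gamma3 : Set SL3R) = ⋂ i : Fin 3, ⋂ j : Fin 3,
      {g : SL3R | (g : Matrix (Fin 3) (Fin 3) ℝ) i j ∈ Set.range ((↑) : ℤ → ℝ)} := by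
    ext g
    simp only [Set.mem_iInter, Set.mem_ofPred_eq, SetLike.mem_coe]
    constructor
    · rintro ⟨γ, rfl⟩ i j
      exact ⟨γ.1 i j, by simp⟩
    · intro h
      choose m hm using h
      have hd : ((Matrix.of m).map (Int.castRingHom ℝ)) = g.1 := by
        ext i j; simp [hm]
      refine ⟨⟨Matrix.of m, ?_⟩, ?_⟩
      · have h1 : ((Matrix.of m).det : ℝ) = 1 := by
          have := RingHom.map_det (Int.castRingHom ℝ) (Matrix.of m)
          simp only [eq_intCast] at this
          rw [this, RingHom.mapMatrix_apply, hd, g.2]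
        exact_mod_cast h1
      · apply Subtype.ext
        exact hd
  rw [h]
  refine isClosed_iInter fun i => isClosed_iInter fun j => ?_
  exact IsClosed.preimage ((continuous_apply_apply i j).comp SL3R.continuous_coe)
    Int.isClosedEmbedding_coe_real.isClosed_range

lemma proj3_eq_iff (a b : SL3R) : proj3 a = proj3 b ↔ b * a⁻¹ ∈ Gamma3 := by
  exact (Quotient.eq'' (s₁ := QuotientGroup.rightRel Gamma3)).trans QuotientGroup.rightRel_apply

lemma proj3_isOpenQuotientMap : IsOpenQuotientMap proj3 where
  surjective := Quotient.mk''_surjective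
  continuous := continuous_quot_mk
  isOpenMap := by
    intro U hU
    have hq : IsQuotientMap proj3 := isQuotientMap_quot_mk
    rw [← hq.isOpen_preimage]
    have : proj3 ⁻¹' (proj3 '' U) = ⋃ γ : Gamma3, (fun g => γ.1 * g) ⁻¹' U := by
      ext g
      simp only [Set.mem_preimage, Set.mem_image, Set.mem_iUnion]
      constructor
      · rintro ⟨u, hu, he⟩
        rw [proj3_eq_iff] at he
        refine ⟨⟨(g * u⁻¹)⁻¹, inv_mem he⟩, ?_⟩
        simpa using hu
      · rintro ⟨γ, hγ⟩
        refine ⟨_, hγ, ?_⟩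
        rw [proj3_eq_iff]
        simp
    rw [this]
    exact isOpen_iUnion fun γ => hU.preimage (continuous_const_mul _)

lemma rmul3_proj3 (g h : SL3R) : rmul3 g (proj3 h) = proj3 (h * g) := rfl

instance X3.mulAction : MulAction SL3R X3 where
  smul g x := rmul3 g⁻¹ x
  one_smul x := by
    obtain ⟨h, rfl⟩ := proj3_isOpenQuotientMap.surjective x
    change rmul3 _ _ = _
    simp [rmul3_proj3]
  mul_smul a b x := by
    obtain ⟨h, rfl⟩ := proj3_isOpenQuotientMap.surjective x
    change rmul3 _ _ = rmul3 _ (rmul3 _ _)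
    simp [rmul3_proj3, mul_assoc]

lemma X3.smul_proj3 (g h : SL3R) : g • proj3 h = proj3 (h * g⁻¹) := rfl
lemma X3.smul_def (g : SL3R) (x : X3) : g • x = rmul3 g⁻¹ x := rfl

instance X3.continuousSMul : ContinuousSMul SL3R X3 where
  continuous_smul := by
    have h := (IsOpenQuotientMap.id (X := SL3R)).prodMap proj3_isOpenQuotientMap
    rw [h.isQuotientMap.continuous_iff]
    have : ((fun p : SL3R × X3 => p.1 • p.2) ∘ Prod.map id proj3)
        = fun p : SL3R × SL3R => proj3 (p.2 * p.1⁻¹) := by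
      ext p; rfl
    rw [this]
    exact proj3_isOpenQuotientMap.continuous.comp (by fun_prop)

instance X3.pretransitive : MulAction.IsPretransitive SL3R X3 where
  exists_smul_eq x y := by
    obtain ⟨h, rfl⟩ := proj3_isOpenQuotientMap.surjective x
    obtain ⟨k, rfl⟩ := proj3_isOpenQuotientMap.surjective y
    exact ⟨k⁻¹ * h, by simp [X3.smul_proj3]⟩

instance X3.t2 : T2Space X3 := by
  rw [t2Space_iff_of_isOpenQuotientMap proj3_isOpenQuotientMap]
  simp_rw [proj3_eq_iff]
  exact Gamma3_isClosed.preimage (f := fun q : SL3R × SL3R => q.2 * q.1⁻¹) (by fun_prop)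

instance X3.lcs : LocallyCompactSpace X3 :=
  proj3_isOpenQuotientMap.locallyCompactSpace

instance X3.sc : SecondCountableTopology X3 :=
  proj3_isOpenQuotientMap.isQuotientMap.secondCountableTopology proj3_isOpenQuotientMap.isOpenMap

instance X3.borel : BorelSpace X3 := ⟨rfl⟩

lemma X3.smulInvariant (μ : Measure X3) (h : ∀ g : SL3R, Measure.map (rmul3 g) μ = μ) :
    SMulInvariantMeasure SL3R X3 μ where
  measure_preimage_smul g s hs := by
    have hm : Measurable (rmul3 g⁻¹) := (continuous_const_smul (T := X3) g).measurable
    conv_rhs => rw [← h g⁻¹, Measure.map_apply hm hs]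
    rfl
end

section

/-- elementary matrices -/
abbrev tv {i j : Fin 3} (h : i ≠ j) (x : ℝ) : SL3R := Matrix.SpecialLinearGroup.transvection h x

lemma tv_continuous {i j : Fin 3} (h : i ≠ j) : Continuous (fun x : ℝ => tv h x) := by
  rw [SL3R.continuous_iff]
  refine continuous_pi fun a => continuous_pi fun b => ?_
  simp only [Matrix.SpecialLinearGroup.transvection_coe, Matrix.add_apply, Matrix.single_apply]
  split_ifs <;> fun_prop

lemma tv_identity {i j : Fin 3} (h : i ≠ j) (c e : ℝ) (hc : c ≠ 0) (he : e ≠ 0) :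
    tv h ((c - 1) / e) * tv h.symm e * tv h ((c⁻¹ - 1) / e) =
      tv h.symm (e / c) * Matrix.SpecialLinearGroup.diag2n h c hc := by
  ext a b
  simp only [Matrix.SpecialLinearGroup.coe_mul, Matrix.SpecialLinearGroup.transvection_coe,
    Matrix.SpecialLinearGroup.diag2n_coe, Matrix.mul_apply, Fin.sum_univ_three, Matrix.add_apply,
    Matrix.one_apply, Matrix.single_apply, Matrix.diagonal_apply]
  fin_cases i <;> fin_cases j <;> first | exact absurd rfl h | skip
  all_goals fin_cases a <;> fin_cases b <;> simp <;> field_simp <;> ring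

lemma diag_conj {i j : Fin 3} (h : i ≠ j) (c x : ℝ) (hc : c ≠ 0) :
    Matrix.SpecialLinearGroup.diag2n h c hc * tv h.symm x =
      tv h.symm (x / c ^ 2) * Matrix.SpecialLinearGroup.diag2n h c hc := by
  ext a b
  simp only [Matrix.SpecialLinearGroup.coe_mul, Matrix.SpecialLinearGroup.transvection_coe,
    Matrix.SpecialLinearGroup.diag2n_coe, Matrix.mul_apply, Fin.sum_univ_three, Matrix.add_apply,
    Matrix.one_apply, Matrix.single_apply, Matrix.diagonal_apply]
  fin_cases i <;> fin_cases j <;> first | exact absurd rfl h | skip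
  all_goals fin_cases a <;> fin_cases b <;> simp <;> field_simp

lemma tv_comm {i j k : Fin 3} (hij : i ≠ j) (hjk : j ≠ k) (hik : i ≠ k) (x : ℝ) :
    tv hij x * tv hjk 1 = tv hik x * (tv hjk 1 * tv hij x) := by
  ext a b
  simp only [Matrix.SpecialLinearGroup.coe_mul, Matrix.SpecialLinearGroup.transvection_coe,
    Matrix.mul_apply, Fin.sum_univ_three, Matrix.add_apply,
    Matrix.one_apply, Matrix.single_apply]
  fin_cases i <;> fin_cases j <;>
    first | exact absurd rfl hij | (fin_cases k <;>
      first | exact absurd rfl hik | exact absurd rfl hjk | skip)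
  all_goals fin_cases a <;> fin_cases b <;> simp

section mautner

lemma mautner_diag (S : Subgroup SL3R) (φ : SL3R → ℝ) (hφ : Continuous φ)
  (hS : ∀ g, φ g = φ 1 → g ∈ S) (hb : ∀ s ∈ S, ∀ t ∈ S, ∀ g, φ (s * g * t) = φ g)
    {i j : Fin 3} (h : i ≠ j) (ht : ∀ x, tv h x ∈ S) (c : ℝ) (hc : c ≠ 0) :
    Matrix.SpecialLinearGroup.diag2n h c hc ∈ S := by
  apply hS
  set d : SL3R := Matrix.SpecialLinearGroup.diag2n h c hc
  have h1 : Tendsto (fun e : ℝ => φ (tv h.symm e)) (𝓝[≠] 0) (𝓝 (φ 1)) := by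
    have : Continuous (fun e : ℝ => φ (tv h.symm e)) := hφ.comp (tv_continuous _)
    have h2 := this.tendsto 0
    simp only [Matrix.SpecialLinearGroup.transvection_coeff_zero] at h2
    exact h2.mono_left nhdsWithin_le_nhds
  have h2 : Tendsto (fun e : ℝ => φ (tv h.symm (e / c) * d)) (𝓝[≠] 0) (𝓝 (φ d)) := by
    have : Continuous (fun e : ℝ => φ (tv h.symm (e / c) * d)) :=
      hφ.comp (((tv_continuous h.symm).comp (continuous_id.div_const c)).mul continuous_const)
    have h2 := this.tendsto 0
    simp only [zero_div, Matrix.SpecialLinearGroup.transvection_coeff_zero, one_mul] at h2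
    exact h2.mono_left nhdsWithin_le_nhds
  refine tendsto_nhds_unique (h2.congr' ?_) h1
  filter_upwards [self_mem_nhdsWithin] with e he
  rw [← tv_identity h c e hc he, hb _ (ht _) _ (ht _)]

lemma mautner_opp (S : Subgroup SL3R) (φ : SL3R → ℝ) (hφ : Continuous φ)
  (hS : ∀ g, φ g = φ 1 → g ∈ S) (hb : ∀ s ∈ S, ∀ t ∈ S, ∀ g, φ (s * g * t) = φ g)
    {i j : Fin 3} (h : i ≠ j) (ht : ∀ x, tv h x ∈ S) (x : ℝ) :
    tv h.symm x ∈ S := by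
  apply hS
  have h1 : Tendsto (fun c : ℝ => φ (tv h.symm (x / c ^ 2))) atTop (𝓝 (φ 1)) := by
    have : Continuous (fun e : ℝ => φ (tv h.symm e)) := hφ.comp (tv_continuous _)
    have h2 := this.tendsto 0
    simp only [Matrix.SpecialLinearGroup.transvection_coeff_zero] at h2
    exact h2.comp (tendsto_const_nhds.div_atTop (tendsto_pow_atTop two_ne_zero))
  refine tendsto_nhds_unique (tendsto_const_nhds.congr' ?_) h1
  filter_upwards [eventually_ne_atTop 0] with c hc
  have hd := mautner_diag S φ hφ hS hb h ht c hc
  have := hb _ hd _ (inv_mem hd) (tv h.symm x)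
  rw [diag_conj, mul_assoc, mul_inv_cancel, mul_one] at this
  exact this.symm

lemma mautner_top (S : Subgroup SL3R) (φ : SL3R → ℝ) (hφ : Continuous φ)
  (hS : ∀ g, φ g = φ 1 → g ∈ S) (hb : ∀ s ∈ S, ∀ t ∈ S, ∀ g, φ (s * g * t) = φ g)
    (h1 : ∀ x, tv (show (0 : Fin 3) ≠ 1 by decide) x ∈ S)
    (h2 : ∀ x, tv (show (0 : Fin 3) ≠ 2 by decide) x ∈ S) : S = ⊤ := by
  have h10 := mautner_opp S φ hφ hS hb _ h1
  have h20 := mautner_opp S φ hφ hS hb _ h2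
  have hcomm : ∀ {i j k : Fin 3} (hij : i ≠ j) (hjk : j ≠ k) (hik : i ≠ k),
      (∀ x, tv hij x ∈ S) → (∀ x, tv hjk x ∈ S) → ∀ x, tv hik x ∈ S := by
    intro i j k hij hjk hik ha hb x
    have := mul_mem (ha x) (hb 1)
    rw [tv_comm hij hjk hik] at this
    exact (Subgroup.mul_mem_cancel_right S (mul_mem (hb 1) (ha x))).1 this
  have h12 := hcomm (show (1 : Fin 3) ≠ 0 by decide) (show (0 : Fin 3) ≠ 2 by decide)
    (show (1 : Fin 3) ≠ 2 by decide) h10 h2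
  have h21 := hcomm (show (2 : Fin 3) ≠ 0 by decide) (show (0 : Fin 3) ≠ 1 by decide)
    (show (2 : Fin 3) ≠ 1 by decide) h20 h1
  have hall : ∀ (i j : Fin 3) (h : i ≠ j) (x : ℝ), tv h x ∈ S := by
    intro i j h x
    fin_cases i <;> fin_cases j <;> first | exact absurd rfl h | skip
    · exact h1 x
    · exact h2 x
    · exact h10 x
    · exact h12 x
    · exact h20 x
    · exact h21 x
  rw [eq_top_iff]
  intro M _
  refine Matrix.SpecialLinearGroup.diagonal_transvection_induction' (· ∈ S) M ?_ hall
    (fun A B => mul_mem)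
  intro i j hij c hc
  exact mautner_diag S φ hφ hS hb hij (hall i j hij) c hc
end mautner
end

section
set_option linter.unusedSectionVars false

instance SL3R.meas : MeasurableSpace SL3R := borel SL3R
instance SL3R.borelSpace : BorelSpace SL3R := ⟨rfl⟩

/-- triples of column vectors -/
abbrev W3 := (Fin 3 → ℝ) × (Fin 3 → ℝ) × (Fin 3 → ℝ)

lemma W3_vol_pos {U : Set W3} (hU : IsOpen U) (h : U.Nonempty) : 0 < volume U :=
  haveI : ((volume : Measure (Fin 3 → ℝ)).prod
    (volume : Measure (Fin 3 → ℝ))).IsOpenPosMeasure :=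
    MeasureTheory.Measure.prod.instIsOpenPosMeasure
  haveI : ((volume : Measure (Fin 3 → ℝ)).prod ((volume : Measure (Fin 3 → ℝ)).prod
    (volume : Measure (Fin 3 → ℝ)))).IsOpenPosMeasure :=
    MeasureTheory.Measure.prod.instIsOpenPosMeasure
  hU.measure_pos ((volume : Measure (Fin 3 → ℝ)).prod ((volume : Measure (Fin 3 → ℝ)).prod
    (volume : Measure (Fin 3 → ℝ)))) h

/-- the matrix with given columns -/
def colM (w : W3) : Matrix (Fin 3) (Fin 3) ℝ :=
  Matrix.of fun i j => ![w.1 i, w.2.1 i, w.2.2 i] j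

lemma colM_continuous : Continuous colM := by
  refine continuous_pi fun i => continuous_pi fun j => ?_
  unfold colM
  fin_cases j <;> simp <;> fun_prop

/-- left multiplication on columns -/
def lmulW (g : SL3R) (w : W3) : W3 := (g.1 *ᵥ w.1, g.1 *ᵥ w.2.1, g.1 *ᵥ w.2.2)

lemma colM_lmulW (g : SL3R) (w : W3) : colM (lmulW g w) = g.1 * colM w := by
  ext i j
  fin_cases j <;> simp [colM, lmulW, Matrix.mul_apply, Matrix.mulVec, dotProduct]

lemma det_colM_lmulW (g : SL3R) (w : W3) : (colM (lmulW g w)).det = (colM w).det := by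
  rw [colM_lmulW, Matrix.det_mul, g.2, one_mul]

lemma mulVec_mp (g : SL3R) : MeasurePreserving (fun v : Fin 3 → ℝ => g.1 *ᵥ v) := by
  refine ⟨(Continuous.matrix_mulVec continuous_const continuous_id).measurable, ?_⟩
  have := Real.map_matrix_volume_pi_eq_smul_volume_pi (M := g.1) (by rw [g.2]; exact one_ne_zero)
  rw [g.2] at this
  have h2 : Measure.map (Matrix.toLin' g.1) volume = (volume : Measure (Fin 3 → ℝ)) := by
    simpa using this
  exact h2

lemma lmulW_mp (g : SL3R) : MeasurePreserving (lmulW g) :=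
  (mulVec_mp g).prod ((mulVec_mp g).prod (mulVec_mp g))

lemma nrm_aux (A : Matrix (Fin 3) (Fin 3) ℝ) (h : 0 < A.det) :
    (A.det ^ (-(1/3) : ℝ) • A).det = 1 := by
  rw [Matrix.det_smul, Fintype.card_fin, ← Real.rpow_natCast, ← Real.rpow_mul h.le]
  norm_num
  rw [Real.rpow_neg_one]
  exact inv_mul_cancel₀ h.ne'

open Classical in
/-- normalisation to determinant one -/
def nrmW (w : W3) : SL3R :=
  if h : 0 < (colM w).det then (⟨(colM w).det ^ (-(1/3) : ℝ) • colM w, nrm_aux _ h⟩ : SL3R) else 1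

lemma nrmW_coe (w : W3) (h : 0 < (colM w).det) :
    (nrmW w).1 = (colM w).det ^ (-(1/3) : ℝ) • colM w := by
  exact congrArg Subtype.val (dif_pos h)

lemma nrmW_lmulW (g : SL3R) (w : W3) (h : 0 < (colM w).det) :
    nrmW (lmulW g w) = g * nrmW w := by
  apply Subtype.ext
  rw [nrmW_coe _ (by rwa [det_colM_lmulW]), det_colM_lmulW, colM_lmulW]
  rw [Matrix.SpecialLinearGroup.coe_mul]
  erw [nrmW_coe _ h]
  rw [Matrix.mul_smul]

/-- the domain of positive determinant -/
def posW : Set W3 := {w | 0 < (colM w).det}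

lemma posW_open : IsOpen posW :=
  isOpen_lt continuous_const colM_continuous.matrix_det

lemma posW_nonempty : posW.Nonempty := by
  refine ⟨(![1,0,0], ![0,1,0], ![0,0,1]), ?_⟩
  simp [posW, colM, Matrix.det_fin_three]

lemma nrmW_continuousOn : ContinuousOn nrmW posW := by
  rw [SL3R.isClosedEmbedding_coe.isInducing.continuousOn_iff]
  have h : ContinuousOn (fun w => (colM w).det ^ (-(1/3) : ℝ) • colM w) posW := by
    refine ContinuousOn.smul (f := fun w => (colM w).det ^ (-(1/3) : ℝ)) (g := colM) ?_ colM_continuous.continuousOn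
    refine ContinuousOn.rpow_const colM_continuous.matrix_det.continuousOn ?_
    intro w hw
    exact Or.inl (ne_of_gt hw)
  refine h.congr ?_
  intro w hw
  exact nrmW_coe w hw

lemma nrmW_measurable : Measurable nrmW := by
  classical
  have h : nrmW = posW.piecewise nrmW (fun _ => 1) := by
    ext1 w
    by_cases hw : w ∈ posW
    · rw [Set.piecewise_eq_of_mem _ _ _ hw]
    · rw [Set.piecewise_eq_of_notMem _ _ _ hw]
      exact dif_neg hw
  rw [h]
  exact nrmW_continuousOn.measurable_piecewise continuousOn_const posW_open.measurableSet

lemma exists_pt_of_ae {X : Type*} [MeasurableSpace X] (μ : Measure X) [IsProbabilityMeasure μ]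
    {p : X → Prop} (h : ∀ᵐ x ∂μ, p x) : ∃ x, p x :=
  haveI : NeZero μ := ⟨IsProbabilityMeasure.ne_zero μ⟩
  h.exists

section
variable {X : Type*} [TopologicalSpace X] [SecondCountableTopology X] [MeasurableSpace X]
  [BorelSpace X] [MulAction SL3R X] [ContinuousSMul SL3R X] 

lemma actW_aux1 : Measurable (fun p : SL3R × X => p.1⁻¹ • p.2) :=
  ((continuous_fst.inv).smul continuous_snd).measurable

lemma actW_aux2 : Measurable (fun p : X × W3 => (nrmW p.2, p.1)) :=
  (nrmW_measurable.comp measurable_snd).prodMk measurable_fst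

lemma actW_aux3 :
    Measurable ((fun p : SL3R × X => p.1⁻¹ • p.2) ∘ (fun p : X × W3 => (nrmW p.2, p.1))) :=
  Measurable.comp actW_aux1 actW_aux2

lemma actW_measurable : Measurable (fun p : X × W3 => (nrmW p.2)⁻¹ • p.1) := actW_aux3

/-- parameter set hitting `E` -/
def hitW (E : Set X) (x : X) : Set W3 := {w | w ∈ posW ∧ (nrmW w)⁻¹ • x ∈ E}

lemma hitW_measurable {E : Set X} (hE : MeasurableSet E) :
    MeasurableSet {p : X × W3 | p.2 ∈ hitW E p.1} :=
  (measurable_snd posW_open.measurableSet).inter (actW_measurable hE)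

lemma hitW_smul (E : Set X) (x : X) (h : SL3R) : hitW E (h⁻¹ • x) = lmulW h ⁻¹' hitW E x := by
  ext w
  simp only [hitW, posW, Set.mem_ofPred_eq, Set.mem_preimage, det_colM_lmulW]
  refine and_congr_right fun hw => ?_
  rw [nrmW_lmulW h w hw, _root_.mul_inv_rev, mul_smul]

lemma hitW_section_measurable {E : Set X} (hE : MeasurableSet E) (x : X) :
    MeasurableSet (hitW E x) :=
  measurable_prodMk_left (x := x) (hitW_measurable hE)

variable [MulAction.IsPretransitive SL3R X]

lemma hitW_vol {E : Set X} (hE : MeasurableSet E) (x y : X) :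
    volume (hitW E x) = volume (hitW E y) := by
  obtain ⟨g, rfl⟩ := MulAction.exists_smul_eq SL3R x y
  rw [← inv_inv g, hitW_smul, (lmulW_mp g⁻¹).measure_preimage
    (hitW_section_measurable hE x).nullMeasurableSet]

variable (μ : Measure X) [IsProbabilityMeasure μ] [SMulInvariantMeasure SL3R X μ]

lemma hitW_null {E : Set X} (hE : MeasurableSet E) (h0 : μ E = 0) (x : X) :
    volume (hitW E x) = 0 := by
  have hQ := hitW_measurable hE
  have h1 : (μ.prod volume) {p : X × W3 | p.2 ∈ hitW E p.1} = 0 := by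
    rw [Measure.prod_apply_symm hQ]
    simp only [lintegral_eq_zero_iff (measurable_measure_prodMk_right hQ)]
    refine Eventually.of_forall fun w => ?_
    refine measure_mono_null (t := (fun x => (nrmW w)⁻¹ • x) ⁻¹' E) (fun x hx => hx.2) ?_
    rw [measure_preimage_smul]; exact h0
  rw [Measure.measure_prod_null hQ] at h1
  obtain ⟨y, hy⟩ := exists_pt_of_ae μ h1
  rw [hitW_vol hE x y]
  exact hy

lemma null_of_hitW {E : Set X} (hE : MeasurableSet E) (x : X) (h0 : volume (hitW E x) = 0) :
    μ E = 0 := by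
  have hQ := hitW_measurable hE
  have h1 : (μ.prod volume) {p : X × W3 | p.2 ∈ hitW E p.1} = 0 := by
    rw [Measure.measure_prod_null hQ]
    refine Eventually.of_forall fun y => ?_
    exact (hitW_vol hE y x).trans h0
  rw [Measure.prod_apply_symm hQ, lintegral_eq_zero_iff (measurable_measure_prodMk_right hQ)] at h1
  by_contra hne
  have h2 : ∀ᵐ w : W3, w ∉ posW := by
    filter_upwards [h1] with w hw hpos
    apply hne
    rw [← measure_preimage_smul μ (nrmW w)⁻¹ E, ← nonpos_iff_eq_zero]
    refine le_trans (measure_mono fun x hx => ?_) hw.le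
    exact ⟨hpos, hx⟩
  have h3 : volume posW = 0 := by
    rw [ae_iff] at h2; simpa using h2
  exact (W3_vol_pos posW_open posW_nonempty).ne' h3

lemma const_of_invariant (v : X → ℝ) (hv : Measurable v)
    (hinv : ∀ g : SL3R, ∀ᵐ x ∂μ, v (g • x) = v x) : ∃ c, ∀ᵐ x ∂μ, v x = c := by
  have hQ : MeasurableSet {p : X × W3 | v ((nrmW p.2)⁻¹ • p.1) ≠ v p.1} :=
    (measurableSet_eq_fun (hv.comp actW_measurable) (hv.comp measurable_fst)).compl
  have h1 : (μ.prod volume) {p : X × W3 | v ((nrmW p.2)⁻¹ • p.1) ≠ v p.1} = 0 := by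
    rw [Measure.prod_apply_symm hQ]
    simp only [lintegral_eq_zero_iff (measurable_measure_prodMk_right hQ)]
    refine Eventually.of_forall fun w => ?_
    exact hinv (nrmW w)⁻¹
  rw [Measure.measure_prod_null hQ] at h1
  obtain ⟨y, hy⟩ := exists_pt_of_ae μ h1
  refine ⟨v y, ?_⟩
  rw [ae_iff]
  refine null_of_hitW μ (hv (measurableSet_singleton (v y))).compl y ?_
  exact measure_mono_null (fun w hw => hw.2) hy

end
end

open scoped ENNReal
section
set_option linter.unusedSectionVars false

lemma amat_coe (T : ℝ) : (amat T).1 =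
    Matrix.diagonal ![Real.exp (-2 * T), Real.exp T, Real.exp T] := rfl

lemma amat_tv {j : Fin 3} (h : 0 ≠ j) (T x : ℝ) :
    amat T * tv h x = tv h (Real.exp (-3 * T) * x) * amat T := by
  have e1 : Real.exp (-(2 * T)) = Real.exp (-(3 * T)) * Real.exp T := by
    rw [← Real.exp_add]; congr 1; ring
  ext a b
  simp only [Matrix.SpecialLinearGroup.coe_mul, Matrix.SpecialLinearGroup.transvection_coe,
    Matrix.mul_apply, Fin.sum_univ_three, Matrix.add_apply, amat_coe,
    Matrix.one_apply, Matrix.single_apply, Matrix.diagonal_apply]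
  fin_cases j <;> first | exact absurd rfl h | skip
  all_goals fin_cases a <;> fin_cases b <;> simp
  all_goals rw [e1]; ring

section
variable {X : Type*} [TopologicalSpace X] [T2Space X] [LocallyCompactSpace X]
  [SecondCountableTopology X] [MeasurableSpace X]
  [BorelSpace X] [MulAction SL3R X] [ContinuousSMul SL3R X]
  (μ : Measure X) [IsProbabilityMeasure μ] [SMulInvariantMeasure SL3R X μ]

/-- Koopman operators -/
def koop (g : SL3R) (v : Lp ℝ 2 μ) : Lp ℝ 2 μ := DomMulAct.mk g • v

lemma koop_ae (g : SL3R) (v : Lp ℝ 2 μ) : koop μ g v =ᵐ[μ] fun x => v (g • x) :=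
  DomMulAct.smul_Lp_ae_eq (DomMulAct.mk g) v

lemma koop_koop (g h : SL3R) (v : Lp ℝ 2 μ) : koop μ g (koop μ h v) = koop μ (h * g) v := by
  unfold koop
  rw [DomMulAct.mk_mul, mul_smul]

lemma koop_one (v : Lp ℝ 2 μ) : koop μ 1 v = v := by
  unfold koop
  rw [DomMulAct.mk_one, one_smul]

lemma koop_sub (g : SL3R) (v w : Lp ℝ 2 μ) : koop μ g (v - w) = koop μ g v - koop μ g w :=
  DomMulAct.smul_Lp_sub _ _ _

lemma koop_add (g : SL3R) (v w : Lp ℝ 2 μ) : koop μ g (v + w) = koop μ g v + koop μ g w :=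
  DomMulAct.smul_Lp_add _ _ _

lemma koop_norm (g : SL3R) (v : Lp ℝ 2 μ) : ‖koop μ g v‖ = ‖v‖ := DomMulAct.norm_smul_Lp _ _

lemma koop_inner (g : SL3R) (v w : Lp ℝ 2 μ) :
    inner ℝ (koop μ g v) (koop μ g w) = inner ℝ v w := by
  rw [real_inner_eq_norm_add_mul_self_sub_norm_mul_self_sub_norm_mul_self_div_two,
    real_inner_eq_norm_add_mul_self_sub_norm_mul_self_sub_norm_mul_self_div_two,
    ← koop_add, koop_norm, koop_norm, koop_norm]

lemma koop_inner_left (g : SL3R) (v w : Lp ℝ 2 μ) :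
    inner ℝ (koop μ g v) w = inner ℝ v (koop μ g⁻¹ w) := by
  rw [← koop_inner μ g⁻¹, koop_koop, mul_inv_cancel, koop_one]

lemma koop_continuous (v : Lp ℝ 2 μ) : Continuous (fun g : SL3R => koop μ g v) := by
  haveI : Fact ((2 : ℝ≥0∞) ≠ ∞) := ⟨by norm_num⟩
  have h : Continuous (fun g : SL3Rᵈᵐᵃ => g • v) := continuous_id.smul continuous_const
  exact h.comp DomMulAct.continuous_mk

/-- stabilizer of a vector -/
def stabv (v : Lp ℝ 2 μ) : Subgroup SL3R where
  carrier := {g | koop μ g v = v}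
  mul_mem' := by
    intro a b ha hb
    simp only [Set.mem_ofPred_eq] at *
    rw [← koop_koop, ha, hb]
  one_mem' := koop_one μ v
  inv_mem' := by
    intro a ha
    simp only [Set.mem_ofPred_eq] at *
    conv_lhs => rw [← ha]
    rw [koop_koop, mul_inv_cancel, koop_one]

lemma mem_stabv (v : Lp ℝ 2 μ) (g : SL3R) : g ∈ stabv μ v ↔ koop μ g v = v := Iff.rfl

lemma stabv_top (v : Lp ℝ 2 μ) (h1 : ∀ x, tv (show (0 : Fin 3) ≠ 1 by decide) x ∈ stabv μ v)
    (h2 : ∀ x, tv (show (0 : Fin 3) ≠ 2 by decide) x ∈ stabv μ v) : stabv μ v = ⊤ := by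
  refine mautner_top (stabv μ v) (fun g => inner ℝ (koop μ g v) v) ?_ ?_ ?_ h1 h2
  · exact (koop_continuous μ v).inner continuous_const
  · intro g hg
    simp only [koop_one] at hg
    rw [mem_stabv, ← sub_eq_zero, ← norm_eq_zero, ← sq_eq_zero_iff, norm_sub_sq_real, koop_norm,
      hg, real_inner_self_eq_norm_sq]
    ring
  · intro s hs t ht g
    rw [mem_stabv] at hs ht
    show inner ℝ (koop μ (s * g * t) v) v = inner ℝ (koop μ g v) v
    rw [← koop_koop, ← koop_koop, hs]
    conv_lhs => rw [show inner ℝ (koop μ t (koop μ g v)) v =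
      inner ℝ (koop μ t (koop μ g v)) (koop μ t v) by rw [ht]]
    rw [koop_inner]

/-- the constant function one -/
def oneL : Lp ℝ 2 μ := Lp.const 2 μ (1 : ℝ)

lemma koop_oneL (g : SL3R) : koop μ g (oneL μ) = oneL μ := DomMulAct.smul_Lp_const _ _

lemma oneL_inner_self : inner ℝ (oneL μ) (oneL μ) = (1 : ℝ) := by
  rw [real_inner_self_eq_norm_sq, oneL, Lp.norm_const]
  · simp
  · norm_num

/-- generators of the vectors mixing to zero -/
def genS : Submodule ℝ (Lp ℝ 2 μ) := Submodule.span ℝ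
  {k | ∃ (j : Fin 3) (h : 0 ≠ j) (x : ℝ) (v : Lp ℝ 2 μ), k = koop μ (tv h x) v - v}

variable [MulAction.IsPretransitive SL3R X]

lemma genS_orth (w : Lp ℝ 2 μ) (hw : w ∈ (genS μ)ᗮ) : ∃ c : ℝ, w = c • oneL μ := by
  have hst : ∀ (j : Fin 3) (h : 0 ≠ j) (x : ℝ), tv h x ∈ stabv μ w := by
    intro j h x
    rw [mem_stabv]
    apply ext_inner_right ℝ
    intro v
    rw [koop_inner_left, Matrix.SpecialLinearGroup.transvection_inv]
    have h3 : koop μ (tv h (-x)) v - v ∈ genS μ := Submodule.subset_span ⟨j, h, -x, v, rfl⟩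
    have := Submodule.inner_left_of_mem_orthogonal h3 hw
    rw [inner_sub_right, sub_eq_zero] at this
    exact this
  have htop := stabv_top μ w (hst 1 _) (hst 2 _)
  have hinv : ∀ g : SL3R, ∀ᵐ x ∂μ, w (g • x) = w x := by
    intro g
    have hg : g ∈ stabv μ w := htop ▸ Subgroup.mem_top g
    rw [mem_stabv] at hg
    have := koop_ae μ g w
    rw [hg] at this
    exact this.symm
  obtain ⟨c, hc⟩ := const_of_invariant μ w (Lp.stronglyMeasurable w).measurable hinv
  refine ⟨c, ?_⟩
  apply Lp.ext
  filter_upwards [hc, Lp.coeFn_smul c (oneL μ), Lp.coeFn_const (p := 2) (μ := μ) (1 : ℝ)] with x h1 h2 h3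
  rw [h1, h2, Pi.smul_apply, oneL, h3]
  simp

lemma mix_gen (F : Lp ℝ 2 μ) (k : Lp ℝ 2 μ) (hk : k ∈ genS μ) :
    Tendsto (fun T => inner ℝ (koop μ (amat T) F) k) atTop (𝓝 0) := by
  unfold genS at hk
  induction hk using Submodule.span_induction with
  | zero => simp
  | add a b _ _ ha hb => simpa [inner_add_right] using ha.add hb
  | smul c a _ ha => simpa [inner_smul_right] using ha.const_mul c
  | mem k hk =>
    obtain ⟨j, h, x, v, rfl⟩ := hk
    have e : ∀ T, inner ℝ (koop μ (amat T) F) (koop μ (tv h x) v - v) =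
        inner ℝ (koop μ (amat T) (koop μ (tv h (Real.exp (-3 * T) * (-x))) F - F)) v := by
      intro T
      have : koop μ (tv h x) v = koop μ (tv h (-x))⁻¹ v := by
        rw [Matrix.SpecialLinearGroup.transvection_inv, neg_neg]
      rw [inner_sub_right, this, ← koop_inner_left, koop_koop, amat_tv, ← koop_koop,
        ← inner_sub_left, koop_sub]
    simp_rw [e]
    have h0 : Tendsto (fun T => ‖koop μ (tv h (Real.exp (-3 * T) * (-x))) F - F‖ * ‖v‖) atTop
        (𝓝 0) := by
      have h1 : Tendsto (fun T : ℝ => Real.exp (-3 * T) * (-x)) atTop (𝓝 0) := by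
        have : Tendsto (fun T : ℝ => Real.exp (-3 * T)) atTop (𝓝 0) :=
          Real.tendsto_exp_atBot.comp (tendsto_id.const_mul_atTop_of_neg (by norm_num))
        simpa using this.mul_const (-x)
      have h2 : Continuous (fun y : ℝ => ‖koop μ (tv h y) F - F‖ * ‖v‖) :=
        ((((koop_continuous μ F).comp (tv_continuous h)).sub continuous_const).norm).mul
          continuous_const
      have h3 := (h2.tendsto 0).comp h1
      simp only [Matrix.SpecialLinearGroup.transvection_coeff_zero, koop_one, sub_self, norm_zero,
        zero_mul] at h3
      exact h3
    refine squeeze_zero_norm (fun T => ?_) h0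
    refine (norm_inner_le_norm _ _).trans ?_
    rw [koop_norm]

lemma mix_closure (F : Lp ℝ 2 μ) (k : Lp ℝ 2 μ) (hk : k ∈ (genS μ).topologicalClosure) :
    Tendsto (fun T => inner ℝ (koop μ (amat T) F) k) atTop (𝓝 0) := by
  rw [Metric.tendsto_nhds]
  intro ε hε
  have hk' : k ∈ closure (genS μ : Set (Lp ℝ 2 μ)) := hk
  rw [Metric.mem_closure_iff] at hk'
  obtain ⟨k0, hk0, hd⟩ := hk' (ε / (2 * (‖F‖ + 1))) (by positivity)
  filter_upwards [(Metric.tendsto_nhds.1 (mix_gen μ F k0 hk0)) (ε / 2) (by positivity)] with T hT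
  rw [dist_zero_right] at hT ⊢
  have e : inner ℝ (koop μ (amat T) F) k =
      inner ℝ (koop μ (amat T) F) k0 + inner ℝ (koop μ (amat T) F) (k - k0) := by
    rw [← inner_add_right]; congr 1; abel
  rw [e]
  have h1 : ‖inner ℝ (koop μ (amat T) F) (k - k0)‖ ≤ ‖F‖ * ‖k - k0‖ := by
    refine (norm_inner_le_norm _ _).trans ?_
    rw [koop_norm]
  have h2 : ‖F‖ * ‖k - k0‖ ≤ ε / 2 := by
    rw [← dist_eq_norm]
    have : ‖F‖ * dist k k0 ≤ (‖F‖ + 1) * (ε / (2 * (‖F‖ + 1))) := by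
      gcongr; linarith
    refine this.trans (le_of_eq ?_)
    field_simp
  exact (norm_add_le _ _).trans_lt (by linarith)

lemma mixing_L2 (F h : Lp ℝ 2 μ) :
    Tendsto (fun T => inner ℝ (koop μ (amat T) F) h) atTop
      (𝓝 (inner ℝ F (oneL μ) * inner ℝ (oneL μ) h)) := by
  set m : ℝ := inner ℝ (oneL μ) h
  have hk : h - m • oneL μ ∈ (genS μ).topologicalClosure := by
    rw [← Submodule.orthogonal_orthogonal_eq_closure, Submodule.mem_orthogonal]
    intro w hw
    obtain ⟨c, rfl⟩ := genS_orth μ w hw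
    rw [inner_smul_left, inner_sub_right, inner_smul_right, oneL_inner_self]
    simp [m]
  have h1 := (mix_closure μ F _ hk).add_const (inner ℝ F (oneL μ) * m)
  rw [zero_add] at h1
  refine h1.congr fun T => ?_
  have : inner ℝ (koop μ (amat T) F) (oneL μ) = (inner ℝ F (oneL μ) : ℝ) := by
    rw [koop_inner_left, koop_oneL]
  rw [inner_sub_right, inner_smul_right, this]
  ring

lemma mixing_fun (F h : X → ℝ) (hF : MemLp F 2 μ) (hh : MemLp h 2 μ) :
    Tendsto (fun T => ∫ x, F (amat T • x) * h x ∂μ) atTop (𝓝 ((∫ x, F x ∂μ) * ∫ x, h x ∂μ)) := by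
  have h1 := mixing_L2 μ (hF.toLp F) (hh.toLp h)
  have e1 : inner ℝ (hF.toLp F) (oneL μ) = ∫ x, F x ∂μ := by
    rw [L2.inner_def]
    refine integral_congr_ae ?_
    filter_upwards [hF.coeFn_toLp, Lp.coeFn_const (p := 2) (μ := μ) (1 : ℝ)] with x h1 h2
    rw [h1, oneL, h2]; simp
  have e2 : inner ℝ (oneL μ) (hh.toLp h) = ∫ x, h x ∂μ := by
    rw [L2.inner_def]
    refine integral_congr_ae ?_
    filter_upwards [hh.coeFn_toLp, Lp.coeFn_const (p := 2) (μ := μ) (1 : ℝ)] with x h1 h2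
    rw [h1, oneL, h2]; simp
  rw [e1, e2] at h1
  refine h1.congr fun T => ?_
  rw [L2.inner_def]
  refine integral_congr_ae ?_
  have h5 : koop μ (amat T) (hF.toLp F) = _ := DomMulAct.mk_smul_toLp (amat T) hF
  rw [h5]
  filter_upwards [hh.coeFn_toLp, MemLp.coeFn_toLp (hF.comp_measurePreserving <| measurePreserving_smul (amat T) μ)] with x h1 h2
  rw [h1]
  have h3 : (MemLp.toLp _ (hF.comp_measurePreserving
    (measurePreserving_smul (amat T) μ)) : X → ℝ) x = F (amat T • x) := h2
  refine (congrArg (fun r : ℝ => inner ℝ r (h x)) h3).trans ?_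
  simp [mul_comm]

lemma mixing_ac (F : X → ℝ) (hFc : Continuous F) (C : ℝ) (hF : ∀ x, |F x| ≤ C)
    (m : Measure X) [IsFiniteMeasure m] (hm : m ≪ μ) :
    Tendsto (fun T => ∫ x, F (amat T • x) ∂m) atTop (𝓝 ((∫ x, F x ∂μ) * m.real Set.univ)) := by
  have hC : 0 ≤ C := by
    obtain ⟨x, -⟩ := exists_pt_of_ae μ (p := fun _ => True) (by simp)
    exact (abs_nonneg _).trans (hF x)
  have hF2 : MemLp F 2 μ := MemLp.of_bound hFc.aestronglyMeasurable C (Eventually.of_forall hF)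
  set ρ : X → ℝ := fun x => (m.rnDeriv μ x).toReal
  have hρ : Integrable ρ μ := Measure.integrable_toReal_rnDeriv
  have hρm : ∀ G : X → ℝ, ∫ x, G x ∂m = ∫ x, G x * ρ x ∂μ := by
    intro G
    rw [← integral_rnDeriv_smul hm]
    simp [ρ, mul_comm]
  have hρ1 : m.real Set.univ = ∫ x, ρ x ∂μ := by
    have := hρm (fun _ => 1)
    simpa using this
  have hFm : ∫ x, |F x| ∂μ ≤ C := by
    have := integral_mono_of_nonneg (μ := μ) (Eventually.of_forall fun x => abs_nonneg (F x))
      (integrable_const C) (Eventually.of_forall hF)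
    simpa using this
  have hFm' : |∫ x, F x ∂μ| ≤ C := (abs_integral_le_integral_abs).trans hFm
  simp_rw [hρm]
  rw [hρ1, Metric.tendsto_nhds]
  intro ε hε
  obtain ⟨k, hkc, hk1, hkcont, hkint⟩ :=
    hρ.exists_hasCompactSupport_integral_sub_le (ε := ε / (4 * (C + 1))) (by positivity)
  have hk2 : MemLp k 2 μ := hkcont.memLp_of_hasCompactSupport hkc
  filter_upwards [Metric.tendsto_nhds.1 (mixing_fun μ F k hF2 hk2) (ε / 2) (by positivity)] with T hT
  have hFT : Continuous fun x => F (amat T • x) := hFc.comp (continuous_const_smul _)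
  have hb : ∀ q : X → ℝ, Integrable q μ → Integrable (fun x => F (amat T • x) * q x) μ := by
    intro q hq
    exact hq.bdd_mul hFT.aestronglyMeasurable (Eventually.of_forall fun x => hF _)
  have hCe : C * (ε / (4 * (C + 1))) ≤ ε / 4 := by
    have : C * (ε / (4 * (C + 1))) ≤ (C + 1) * (ε / (4 * (C + 1))) := by gcongr; linarith
    refine this.trans (le_of_eq ?_)
    field_simp
  have a1 : |∫ x, F (amat T • x) * ρ x ∂μ - ∫ x, F (amat T • x) * k x ∂μ| ≤ ε / 4 := by
    rw [← integral_sub (hb _ hρ) (hb _ hkint)]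
    refine (abs_integral_le_integral_abs).trans (le_trans ?_ hCe)
    refine le_trans ?_ (mul_le_mul_of_nonneg_left hk1 hC)
    rw [← integral_const_mul]
    refine integral_mono ((hb _ hρ).sub (hb _ hkint)).abs ((hρ.sub hkint).norm.const_mul C) ?_
    intro x
    simp only
    rw [← mul_sub, abs_mul, Real.norm_eq_abs]
    exact mul_le_mul_of_nonneg_right (hF _) (abs_nonneg _)
  have a2 : |(∫ x, F x ∂μ) * (∫ x, k x ∂μ) - (∫ x, F x ∂μ) * ∫ x, ρ x ∂μ| ≤ ε / 4 := by
    rw [← mul_sub, abs_mul, ← integral_sub hkint hρ]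
    refine le_trans (mul_le_mul hFm' ?_ (abs_nonneg _) hC) hCe
    refine (abs_integral_le_integral_abs).trans (le_trans (le_of_eq ?_) hk1)
    refine integral_congr_ae (Eventually.of_forall fun x => ?_)
    simp only [Real.norm_eq_abs]
    exact abs_sub_comm _ _
  rw [Real.dist_eq] at hT ⊢
  rw [abs_le] at a1 a2
  rw [abs_lt] at hT ⊢
  constructor <;> linarith
end
end

open scoped ENNReal
section
set_option linter.unusedSectionVars false

/-- standard frame -/
def w0 : W3 := (![1,0,0], ![0,1,0], ![0,0,1])

lemma colM_w0 : colM w0 = 1 := by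
  ext i j
  fin_cases i <;> fin_cases j <;> simp [colM, w0]

lemma w0_mem : w0 ∈ posW := by
  simp [posW, colM_w0]

lemma nrmW_w0 : nrmW w0 = 1 := by
  apply Subtype.ext
  rw [nrmW_coe w0 w0_mem, colM_w0]
  simp

/-- block triangular parameters -/
def pW (τ : ℝ) (c : (Fin 3 → ℝ) × (Fin 3 → ℝ)) : W3 := (Real.exp τ • ![1,0,0], c.1, c.2)

/-- contraction of the parameters by conjugation -/
def conV (T : ℝ) (c : Fin 3 → ℝ) : Fin 3 → ℝ := ![Real.exp (-3 * T) * c 0, c 1, c 2]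

lemma amat_neg (T : ℝ) : (amat T)⁻¹ = amat (-T) := by
  rw [inv_eq_iff_mul_eq_one]
  ext a b
  simp only [Matrix.SpecialLinearGroup.coe_mul, amat_coe, Matrix.diagonal_mul_diagonal]
  fin_cases a <;> fin_cases b <;> simp [← Real.exp_add]

lemma colM_con (T τ : ℝ) (c : (Fin 3 → ℝ) × (Fin 3 → ℝ)) :
    colM (pW τ (conV T c.1, conV T c.2)) = (amat T).1 * colM (pW τ c) * (amat (-T)).1 := by
  have e1 : Real.exp (-(2 * T)) = Real.exp (-(3 * T)) * Real.exp T := by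
    rw [← Real.exp_add]; congr 1; ring
  have e2 : Real.exp T * Real.exp (-T) = 1 := by
    rw [← Real.exp_add]; simp
  have e3 : Real.exp (2 * T) * Real.exp (-(2 * T)) = 1 := by
    rw [← Real.exp_add]; simp
  ext a b
  simp only [amat_coe, Matrix.diagonal_mul, Matrix.mul_diagonal]
  fin_cases a <;> fin_cases b <;> simp [colM, pW, conV]
  · linear_combination (-Real.exp τ) * e3
  · rw [e1]; linear_combination (-Real.exp (-(3*T)) * c.1 0) * e2
  · rw [e1]; linear_combination (-Real.exp (-(3*T)) * c.2 0) * e2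
  · linear_combination (- c.1 1) * e2
  · linear_combination (- c.2 1) * e2
  · linear_combination (- c.1 2) * e2
  · linear_combination (- c.2 2) * e2

lemma nrmW_con (T τ : ℝ) (c : (Fin 3 → ℝ) × (Fin 3 → ℝ)) (h : pW τ c ∈ posW) :
    nrmW (pW τ (conV T c.1, conV T c.2)) = amat T * nrmW (pW τ c) * (amat T)⁻¹ := by
  have hd : (colM (pW τ (conV T c.1, conV T c.2))).det = (colM (pW τ c)).det := by
    rw [colM_con, Matrix.det_mul, Matrix.det_mul, (amat T).2, (amat (-T)).2]; ring
  apply Subtype.ext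
  rw [nrmW_coe _ (by rw [hd]; exact h), hd, colM_con, amat_neg, Matrix.SpecialLinearGroup.coe_mul,
    Matrix.SpecialLinearGroup.coe_mul]
  erw [nrmW_coe _ h]
  rw [Matrix.mul_smul, Matrix.smul_mul]

lemma conV_mem (T : ℝ) (hT : 0 ≤ T) (r : ℝ) (c : Fin 3 → ℝ) (e : Fin 3 → ℝ) (he : e 0 = 0)
    (hc : c ∈ Metric.ball e r) : conV T c ∈ Metric.ball e r := by
  have hr : 0 < r := (dist_nonneg).trans_lt hc
  rw [Metric.mem_ball, dist_pi_lt_iff hr] at hc ⊢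
  intro i
  have h := hc i
  rw [Real.dist_eq] at h ⊢
  fin_cases i
  · simp only [conV, Fin.zero_eta, Matrix.cons_val_zero] at h ⊢
    rw [he, sub_zero] at h ⊢
    rw [abs_mul, Real.abs_exp]
    have : Real.exp (-3 * T) ≤ 1 := Real.exp_le_one_iff.2 (by linarith)
    exact (mul_le_of_le_one_left (abs_nonneg _) this).trans_lt h
  · exact h
  · exact h

lemma exists_params (V : Set SL3R) (hV : V ∈ 𝓝 1) :
    ∃ (J : Set ℝ) (U : Set ((Fin 3 → ℝ) × (Fin 3 → ℝ))), MeasurableSet J ∧ MeasurableSet U ∧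
      0 < volume J ∧ volume J < ∞ ∧ 0 < volume U ∧ volume U < ∞ ∧
      ∀ τ ∈ J, ∀ c ∈ U, pW τ c ∈ posW ∧ ∀ T, 0 ≤ T →
        amat T * (nrmW (pW τ c))⁻¹ * (amat T)⁻¹ ∈ V := by
  have hc : ContinuousAt nrmW w0 := nrmW_continuousOn.continuousAt (posW_open.mem_nhds w0_mem)
  have hV' : V⁻¹ ∈ 𝓝 (nrmW w0) := by
    rw [nrmW_w0, ← inv_one]; exact (isOpenMap_inv SL3R).image_mem_nhds hV |> fun h => by simpa using h
  have h1 := Filter.inter_mem (Filter.mem_map.1 (hc hV')) (posW_open.mem_nhds w0_mem)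
  obtain ⟨r, hr, hball⟩ := Metric.mem_nhds_iff.1 h1
  have key : ∀ τ : ℝ, |Real.exp τ - 1| < r → ∀ c : (Fin 3 → ℝ) × (Fin 3 → ℝ),
      c.1 ∈ Metric.ball (![0,1,0] : Fin 3 → ℝ) r → c.2 ∈ Metric.ball (![0,0,1] : Fin 3 → ℝ) r →
      pW τ c ∈ Metric.ball w0 r := by
    intro τ hτ c h1 h2
    rw [Metric.mem_ball, Prod.dist_eq, Prod.dist_eq]
    refine max_lt ?_ (max_lt h1 h2)
    rw [dist_pi_lt_iff hr]
    intro i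
    rw [Real.dist_eq]
    fin_cases i
    · simpa [pW, w0] using hτ
    · simpa [pW, w0] using hr
    · simpa [pW, w0] using hr
  refine ⟨Metric.ball 0 1 ∩ {τ | |Real.exp τ - 1| < r},
    Metric.ball (![0,1,0] : Fin 3 → ℝ) r ×ˢ Metric.ball (![0,0,1] : Fin 3 → ℝ) r, ?_, ?_, ?_, ?_, ?_, ?_, ?_⟩
  · exact measurableSet_ball.inter
      (isOpen_lt (by fun_prop) continuous_const).measurableSet
  · exact measurableSet_ball.prod measurableSet_ball
  · refine (Metric.isOpen_ball.inter (isOpen_lt (by fun_prop) continuous_const)).measure_pos volume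
      ⟨0, by simp, by simpa using hr⟩
  · exact (measure_mono Set.inter_subset_left).trans_lt measure_ball_lt_top
  · rw [Measure.volume_eq_prod, Measure.prod_prod]
    exact ENNReal.mul_pos (Metric.measure_ball_pos volume _ hr).ne'
      (Metric.measure_ball_pos volume _ hr).ne'
  · rw [Measure.volume_eq_prod, Measure.prod_prod]
    exact ENNReal.mul_lt_top measure_ball_lt_top measure_ball_lt_top
  · rintro τ ⟨-, hτ⟩ c ⟨h1, h2⟩
    have hp := (hball (key τ hτ c h1 h2)).2
    refine ⟨hp, fun T hT => ?_⟩
    have h3 := (hball (key τ hτ (conV T c.1, conV T c.2) (conV_mem T hT r _ _ (by simp) h1)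
      (conV_mem T hT r _ _ (by simp) h2))).1
    rw [Set.mem_preimage, nrmW_con _ _ _ hp, Set.mem_inv] at h3
    simpa [_root_.mul_inv_rev, mul_assoc] using h3

/-- the null-set condition on a two parameter family -/
def QN (h : ℝ × ℝ → SL3R) : Prop := ∀ A : Set (Fin 3 → ℝ), MeasurableSet A → volume A = 0 →
  volume {q : (ℝ × ℝ) × ℝ | Real.exp q.2 • ((h q.1).1 *ᵥ ![1,0,0]) ∈ A} = 0

/-- full parameter map -/
def PhiW (h : ℝ × ℝ → SL3R) (p : ((ℝ × ℝ) × ℝ) × ((Fin 3 → ℝ) × (Fin 3 → ℝ))) : W3 :=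
  lmulW (h p.1.1) (pW p.1.2 p.2)

lemma PhiW_continuous (h : ℝ × ℝ → SL3R) (hh : Continuous h) : Continuous (PhiW h) := by
  have h1 : Continuous fun p : ((ℝ × ℝ) × ℝ) × ((Fin 3 → ℝ) × (Fin 3 → ℝ)) => (h p.1.1).1 :=
    SL3R.continuous_coe.comp (hh.comp (continuous_fst.comp continuous_fst))
  unfold PhiW lmulW pW
  refine Continuous.prodMk ?_ (Continuous.prodMk ?_ ?_)
  · exact Continuous.matrix_mulVec h1 (by fun_prop)
  · exact Continuous.matrix_mulVec h1 (by fun_prop)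
  · exact Continuous.matrix_mulVec h1 (by fun_prop)

lemma PhiW_null (h : ℝ × ℝ → SL3R) (hh : Continuous h) (hq : QN h) (N : Set W3)
    (hN : MeasurableSet N) (h0 : volume N = 0) : volume (PhiW h ⁻¹' N) = 0 := by
  rw [Measure.volume_eq_prod, Measure.measure_prod_null hN] at h0
  have hNm := measurable_measure_prodMk_left (ν := (volume : Measure ((Fin 3 → ℝ) × (Fin 3 → ℝ)))) hN
  have hA := hq {u | volume (Prod.mk u ⁻¹' N) ≠ 0} (hNm (measurableSet_singleton 0)).compl
    (ae_iff.1 h0)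
  rw [Measure.volume_eq_prod, Measure.measure_prod_null ((PhiW_continuous h hh).measurable hN)]
  rw [Filter.EventuallyEq, ae_iff]
  refine measure_mono_null (fun q hq => ?_) hA
  simp only [Set.mem_ofPred_eq, ne_eq, Pi.zero_apply] at hq ⊢
  intro h1
  apply hq
  have mp := (mulVec_mp (h q.1)).prod (mulVec_mp (h q.1))
  have h2 := mp.quasiMeasurePreserving.preimage_null h1
  refine measure_mono_null (fun c hc => ?_) h2
  have hc' : PhiW h (q, c) ∈ N := hc
  simp only [PhiW, lmulW, pW, Matrix.mulVec_smul] at hc'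
  exact hc'
end

open scoped ENNReal
section
set_option linter.unusedSectionVars false

section
variable {X : Type*} [TopologicalSpace X] [T2Space X] [LocallyCompactSpace X]
  [SecondCountableTopology X] [MeasurableSpace X]
  [BorelSpace X] [MulAction SL3R X] [ContinuousSMul SL3R X]

lemma unif_cont (F : X → ℝ) (hF : Continuous F) (hFc : HasCompactSupport F) (ε : ℝ) (hε : 0 < ε) :
    ∃ V ∈ 𝓝 (1 : SL3R), ∀ g ∈ V, ∀ x, |F (g • x) - F x| < ε := by
  have h1 : ∀ᶠ g in 𝓝 (1 : SL3R), ∀ x ∈ tsupport F, |F (g • x) - F x| < ε := by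
    refine IsCompact.eventually_forall_of_forall_eventually hFc.isCompact fun x _ => ?_
    have hc : Continuous fun z : SL3R × X => |F (z.1 • z.2) - F z.2| :=
      ((hF.comp continuous_smul).sub (hF.comp continuous_snd)).abs
    refine (hc.tendsto (1, x)).eventually (gt_mem_nhds ?_)
    simpa using hε
  have h2 : ∀ᶠ g in 𝓝 (1 : SL3R), ∀ x ∈ tsupport F, |F (g⁻¹ • x) - F x| < ε := by
    have : Tendsto (fun g : SL3R => g⁻¹) (𝓝 1) (𝓝 1) := by
      simpa using (continuous_inv (G := SL3R)).tendsto 1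
    exact this.eventually h1
  refine ⟨_, h1.and h2, fun g hg x => ?_⟩
  by_cases hx : x ∈ tsupport F
  · exact hg.1 x hx
  by_cases hgx : g • x ∈ tsupport F
  · have := hg.2 _ hgx
    rw [inv_smul_smul] at this
    rwa [abs_sub_comm]
  · rw [image_eq_zero_of_notMem_tsupport hx, image_eq_zero_of_notMem_tsupport hgx]
    simpa using hε

/-- thickened orbit map -/
def psiW (h : ℝ × ℝ → SL3R) (x0 : X)
    (p : ((ℝ × ℝ) × ℝ) × ((Fin 3 → ℝ) × (Fin 3 → ℝ))) : X := (nrmW (PhiW h p))⁻¹ • x0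

lemma psiW_aux (h : ℝ × ℝ → SL3R) (hh : Continuous h) (x0 : X) :
    Measurable (fun p => (x0, PhiW h p)) :=
  measurable_const.prodMk (PhiW_continuous h hh).measurable

lemma psiW_aux2 (h : ℝ × ℝ → SL3R) (hh : Continuous h) (x0 : X) :
    Measurable ((fun p : X × W3 => (nrmW p.2)⁻¹ • p.1) ∘ (fun p => (x0, PhiW h p))) :=
  Measurable.comp actW_measurable (psiW_aux h hh x0)

lemma psiW_measurable (h : ℝ × ℝ → SL3R) (hh : Continuous h) (x0 : X) :
    Measurable (psiW h x0) := psiW_aux2 h hh x0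

variable [MulAction.IsPretransitive SL3R X]
variable (μ : Measure X) [IsProbabilityMeasure μ] [SMulInvariantMeasure SL3R X μ]

lemma psiW_ac (h : ℝ × ℝ → SL3R) (hh : Continuous h) (hq : QN h) (x0 : X)
    (M : Measure (((ℝ × ℝ) × ℝ) × ((Fin 3 → ℝ) × (Fin 3 → ℝ)))) (hM : M ≪ volume)
    (hpos : ∀ᵐ p ∂M, pW p.1.2 p.2 ∈ posW) : M.map (psiW h x0) ≪ μ := by
  refine Measure.AbsolutelyContinuous.mk fun E hE h0 => ?_
  rw [Measure.map_apply (psiW_measurable h hh x0) hE]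
  have h1 := hM (PhiW_null h hh hq _ (hitW_section_measurable hE x0) (hitW_null μ hE h0 x0))
  have h2 : ∀ᵐ p ∂M, p ∉ PhiW h ⁻¹' hitW E x0 := by
    rw [ae_iff]; simp only [not_not]; exact h1
  have h3 : ∀ᵐ p ∂M, p ∉ psiW h x0 ⁻¹' E := by
    filter_upwards [hpos, h2] with p hp hp2 hp3
    apply hp2
    refine ⟨?_, hp3⟩
    show 0 < (colM (lmulW _ _)).det
    rw [det_colM_lmulW]; exact hp
  rw [ae_iff] at h3
  simp only [not_not] at h3
  exact h3

lemma equi_K (h : ℝ × ℝ → SL3R) (hh : Continuous h) (hq : QN h) (x0 : X)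
    (F : X → ℝ) (hF : Continuous F) (hFc : HasCompactSupport F)
    (B : Set (ℝ × ℝ)) (hB : MeasurableSet B) (hBf : volume B < ∞) :
    Tendsto (fun T => ∫ s in B, F (amat T • (h s)⁻¹ • x0)) atTop
      (𝓝 ((∫ x, F x ∂μ) * volume.real B)) := by
  obtain ⟨C, hC⟩ : ∃ C, ∀ x, |F x| ≤ C := by
    obtain ⟨C, hC⟩ := hFc.exists_bound_of_continuous hF
    exact ⟨C, hC⟩
  rw [Metric.tendsto_nhds]
  intro δ hδ
  have hb0 : 0 ≤ volume.real B := measureReal_nonneg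
  obtain ⟨V, hV, hVF⟩ := unif_cont F hF hFc (δ / (2 * (volume.real B + 1))) (by positivity)
  obtain ⟨J, U, hJ, hU, hJ0, hJf, hU0, hUf, hpar⟩ := exists_params V hV
  have : IsFiniteMeasure (volume.restrict B) := ⟨by simpa using hBf⟩
  have : IsFiniteMeasure (volume.restrict J) := ⟨by simpa using hJf⟩
  have : IsFiniteMeasure (volume.restrict U) := ⟨by simpa using hUf⟩
  set M := ((volume.restrict B).prod (volume.restrict J)).prod (volume.restrict U) with hMdef
  have hMr : M = (volume.restrict ((B ×ˢ J) ×ˢ U)) := by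
    rw [hMdef, Measure.prod_restrict, Measure.prod_restrict]
    rfl
  have hMae : ∀ᵐ p ∂M, p.1.2 ∈ J ∧ p.2 ∈ U := by
    rw [hMr]
    filter_upwards [ae_restrict_mem ((hB.prod hJ).prod hU)] with p hp
    exact ⟨hp.1.2, hp.2⟩
  have hac := psiW_ac μ h hh hq x0 M (by rw [hMr]; exact Measure.restrict_le_self.absolutelyContinuous)
    (hMae.mono fun p hp => (hpar _ hp.1 _ hp.2).1)
  have hpm := psiW_measurable h hh x0
  have : IsFiniteMeasure (M.map (psiW h x0)) := Measure.isFiniteMeasure_map M _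
  have hmix := mixing_ac μ F hF C hC (M.map (psiW h x0)) hac
  set κ := volume.real J * volume.real U with hκ
  have hκ0 : 0 < κ := mul_pos (ENNReal.toReal_pos hJ0.ne' hJf.ne) (ENNReal.toReal_pos hU0.ne' hUf.ne)
  have hMu : M.real Set.univ = volume.real B * κ := by
    rw [hMdef, ← Set.univ_prod_univ, measureReal_prod_prod, ← Set.univ_prod_univ,
      measureReal_prod_prod]
    simp [hκ, mul_assoc]
  have hmu : (M.map (psiW h x0)).real Set.univ = volume.real B * κ := by
    rw [map_measureReal_apply hpm MeasurableSet.univ, Set.preimage_univ, hMu]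
  rw [hmu] at hmix
  filter_upwards [Metric.tendsto_nhds.1 hmix (κ * (δ / 2)) (by positivity), eventually_ge_atTop 0]
    with T hT hT0
  have hFT : Continuous fun x => F (amat T • x) := hF.comp (continuous_const_smul _)
  rw [integral_map hpm.aemeasurable hFT.aestronglyMeasurable] at hT
  have hGc : Continuous fun s => F (amat T • (h s)⁻¹ • x0) :=
    hFT.comp (hh.inv.smul continuous_const)
  have e1 : ∫ p, F (amat T • (h p.1.1)⁻¹ • x0) ∂M = κ * ∫ s in B, F (amat T • (h s)⁻¹ • x0) := by
    rw [hMdef, integral_fun_fst (fun q : (ℝ × ℝ) × ℝ => F (amat T • (h q.1)⁻¹ • x0)),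
      integral_fun_fst (fun q : ℝ × ℝ => F (amat T • (h q)⁻¹ • x0))]
    simp [hκ]; ring
  have i1 : Integrable (fun p => F (amat T • (h p.1.1)⁻¹ • x0)) M :=
    Integrable.of_bound (C := C) (hGc.comp (continuous_fst.comp continuous_fst)).aestronglyMeasurable
      (Eventually.of_forall fun p => hC _)
  have i2 : Integrable (fun p => F (amat T • psiW h x0 p)) M :=
    Integrable.of_bound (C := C) (hFT.measurable.comp hpm).aestronglyMeasurable
      (Eventually.of_forall fun p => hC _)
  have a1 : |∫ p, F (amat T • psiW h x0 p) ∂M - ∫ p, F (amat T • (h p.1.1)⁻¹ • x0) ∂M| ≤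
      δ / (2 * (volume.real B + 1)) * (volume.real B * κ) := by
    rw [← integral_sub i2 i1, ← hMu]
    rw [← Real.norm_eq_abs]
    refine (norm_integral_le_of_norm_le_const (G := ℝ) (μ := M) (C := δ / (2 * (volume.real B + 1))) ?_)
    filter_upwards [hMae] with p hp
    obtain ⟨hp1, hp2⟩ := hpar _ hp.1 _ hp.2
    have := hVF _ (hp2 T hT0) (amat T • (h p.1.1)⁻¹ • x0)
    have e : amat T • psiW h x0 p = (amat T * (nrmW (pW p.1.2 p.2))⁻¹ * (amat T)⁻¹) •
        (amat T • (h p.1.1)⁻¹ • x0) := by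
      rw [psiW, PhiW, nrmW_lmulW _ _ hp1]
      simp only [smul_smul]
      congr 1
      group
    rw [e]
    exact this.le
  rw [e1] at a1
  have a2 : δ / (2 * (volume.real B + 1)) * (volume.real B * κ) ≤ κ * (δ / 2) := by
    have : δ / (2 * (volume.real B + 1)) * (volume.real B * κ) ≤
        δ / (2 * (volume.real B + 1)) * ((volume.real B + 1) * κ) := by gcongr; linarith
    refine this.trans (le_of_eq ?_)
    field_simp
  rw [Real.dist_eq] at hT ⊢
  have a3 : κ * |(∫ s in B, F (amat T • (h s)⁻¹ • x0)) - (∫ x, F x ∂μ) * volume.real B| < κ * δ := by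
    rw [← abs_of_pos hκ0, ← abs_mul, abs_of_pos hκ0]
    rw [abs_le] at a1
    rw [abs_lt] at hT ⊢
    constructor <;> nlinarith
  exact lt_of_mul_lt_mul_left a3 hκ0.le
end
end

open scoped ENNReal
section
set_option linter.unusedSectionVars false

section
variable {X : Type*} [TopologicalSpace X] [T2Space X] [LocallyCompactSpace X]
  [SecondCountableTopology X] [MeasurableSpace X] [BorelSpace X]
  (μ : Measure X) [IsProbabilityMeasure μ]

lemma exists_cutoff (ε : ℝ) (hε : 0 < ε) : ∃ χ : X → ℝ, Continuous χ ∧ HasCompactSupport χ ∧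
    (∀ x, 0 ≤ χ x) ∧ (∀ x, χ x ≤ 1) ∧ 1 - ε ≤ ∫ x, χ x ∂μ := by
  obtain ⟨k, hkc, hk1, hkcont, hkint⟩ :=
    (integrable_const (μ := μ) (1 : ℝ)).exists_hasCompactSupport_integral_sub_le hε
  have hc : Continuous fun x => max 0 (min (k x) 1) :=
    continuous_const.max (hkcont.min continuous_const)
  have hi : Integrable (fun x => max 0 (min (k x) 1)) μ :=
    Integrable.of_bound (C := 1) hc.aestronglyMeasurable (Eventually.of_forall fun x => by
      rw [Real.norm_eq_abs, abs_of_nonneg (le_max_left _ _)]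
      exact max_le zero_le_one (min_le_right _ _))
  refine ⟨fun x => max 0 (min (k x) 1), hc, ?_, fun x => le_max_left _ _,
    fun x => max_le zero_le_one (min_le_right _ _), ?_⟩
  · exact hkc.comp_left (g := fun r : ℝ => max 0 (min r 1)) (by simp)
  · have h1 : ∫ x, (1 - max 0 (min (k x) 1)) ∂μ ≤ ∫ x, ‖1 - k x‖ ∂μ := by
      refine integral_mono ((integrable_const 1).sub hi) ((integrable_const 1).sub hkint).norm ?_
      intro x
      simp only [Real.norm_eq_abs]
      rcases le_total (k x) 1 with h | h
      · rw [min_eq_left h]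
        exact le_trans (by linarith [le_max_right 0 (k x)]) (le_abs_self _)
      · rw [min_eq_right h]
        simp
    rw [integral_sub (integrable_const 1) hi] at h1
    simp at h1
    simp at hk1
    linarith

/-- fibrewise integral -/
lemma cont_fib (f : (ℝ × ℝ) × X → ℝ) (hf : Continuous f) (C : ℝ) (hC : ∀ p, |f p| ≤ C) :
    Continuous fun s => ∫ y, f (s, y) ∂μ := by
  refine continuous_of_dominated (bound := fun _ => C) (fun s => ?_) (fun s => ?_)
    (integrable_const C) ?_
  · exact (hf.comp (by fun_prop)).aestronglyMeasurable
  · exact Eventually.of_forall fun y => hC _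
  · exact Eventually.of_forall fun y => hf.comp (by fun_prop)

lemma fib_bound (f : (ℝ × ℝ) × X → ℝ) (C : ℝ) (hC : ∀ p, |f p| ≤ C) (s : ℝ × ℝ) :
    |∫ y, f (s, y) ∂μ| ≤ C := by
  have := norm_integral_le_of_norm_le_const (μ := μ) (C := C) (f := fun y => f (s, y))
    (Eventually.of_forall fun y => hC _)
  simpa using this

lemma intOn_of_bdd (g : ℝ × ℝ → ℝ) (hg : Continuous g) (C : ℝ) (hC : ∀ s, |g s| ≤ C)
    (B : Set (ℝ × ℝ)) (hBf : volume B < ∞) : IntegrableOn g B := by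
  have : IsFiniteMeasure (volume.restrict B) := ⟨by simpa using hBf⟩
  exact Integrable.of_bound (C := C) hg.aestronglyMeasurable (Eventually.of_forall hC)

/-- approximate equidistribution on all subsets -/
def goodS (x : ℝ → ℝ × ℝ → X) (f : (ℝ × ℝ) × X → ℝ) (ε : ℝ) (S : Set (ℝ × ℝ)) : Prop :=
  ∃ S', MeasurableSet S' ∧ S ⊆ S' ∧ ∀ B ⊆ S', MeasurableSet B → volume B < ∞ → ∀ δ > 0,
    ∀ᶠ T in atTop, |(∫ s in B, f (s, x T s)) - ∫ s in B, ∫ y, f (s, y) ∂μ| ≤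
      2 * ε * volume.real B + δ

lemma goodS_local (x : ℝ → ℝ × ℝ → X) (hx : ∀ T, Continuous (x T))
  (hK : ∀ F : X → ℝ, Continuous F → HasCompactSupport F → ∀ B : Set (ℝ × ℝ), MeasurableSet B →
    volume B < ∞ → Tendsto (fun T => ∫ s in B, F (x T s)) atTop
      (𝓝 ((∫ y, F y ∂μ) * volume.real B)))
    (f : (ℝ × ℝ) × X → ℝ) (hf : Continuous f) (C : ℝ) (hC : ∀ p, |f p| ≤ C)
    (L : Set X) (hL : IsCompact L) (hfL : ∀ s, ∀ y ∉ L, f (s, y) = 0) (ε : ℝ) (hε : 0 < ε)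
    (s0 : ℝ × ℝ) : ∃ S ∈ 𝓝 s0, goodS μ x f ε S := by
  have h1 : ∀ᶠ s in 𝓝 s0, ∀ y ∈ L, |f (s, y) - f (s0, y)| < ε := by
    refine IsCompact.eventually_forall_of_forall_eventually hL fun y _ => ?_
    have hc : Continuous fun z : (ℝ × ℝ) × X => |f z - f (s0, z.2)| := by fun_prop
    refine (hc.tendsto (s0, y)).eventually (gt_mem_nhds ?_)
    simpa using hε
  obtain ⟨S, hS, hSo, hs0⟩ := eventually_nhds_iff.1 h1
  have hS2 : ∀ s ∈ S, ∀ y, |f (s, y) - f (s0, y)| ≤ ε := by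
    intro s hs y
    by_cases hy : y ∈ L
    · exact (hS s hs y hy).le
    · rw [hfL _ _ hy, hfL _ _ hy]; simpa using hε.le
  refine ⟨S, hSo.mem_nhds hs0, S, hSo.measurableSet, subset_rfl, fun B hBS hB hBf δ hδ => ?_⟩
  have hF : Continuous fun y => f (s0, y) := hf.comp (by fun_prop)
  have hFc : HasCompactSupport fun y => f (s0, y) := HasCompactSupport.intro hL (fun y hy => hfL _ _ hy)
  filter_upwards [Metric.tendsto_nhds.1 (hK _ hF hFc B hB hBf) δ hδ] with T hT
  have i1 := intOn_of_bdd (fun s => f (s, x T s)) (hf.comp (continuous_id.prodMk (hx T))) C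
    (fun s => hC _) B hBf
  have i2 := intOn_of_bdd (fun s => f (s0, x T s)) (hF.comp (hx T)) C (fun s => hC _) B hBf
  have i3 := intOn_of_bdd _ (cont_fib μ f hf C hC) C (fib_bound μ f C hC) B hBf
  have i4 := intOn_of_bdd (fun _ => ∫ y, f (s0, y) ∂μ) continuous_const C
    (fun _ => fib_bound μ f C hC s0) B hBf
  have a1 : |(∫ s in B, f (s, x T s)) - ∫ s in B, f (s0, x T s)| ≤ ε * volume.real B := by
    rw [← integral_sub i1 i2, ← Real.norm_eq_abs]
    exact norm_setIntegral_le_of_norm_le_const hBf (fun s hs => hS2 s (hBS hs) _)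
  have a2 : |(∫ s in B, ∫ y, f (s, y) ∂μ) - ∫ s in B, ∫ y, f (s0, y) ∂μ| ≤ ε * volume.real B := by
    rw [← integral_sub i3 i4, ← Real.norm_eq_abs]
    refine norm_setIntegral_le_of_norm_le_const hBf (fun s hs => ?_)
    have j1 : ∀ s, Integrable (fun y => f (s, y)) μ := fun s =>
      Integrable.of_bound (C := C) (hf.comp (by fun_prop)).aestronglyMeasurable
        (Eventually.of_forall fun y => hC _)
    rw [← integral_sub (j1 s) (j1 s0)]
    have := norm_integral_le_of_norm_le_const (μ := μ) (C := ε) (f := fun y => f (s, y) - f (s0, y))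
      (Eventually.of_forall fun y => hS2 s (hBS hs) y)
    simpa using this
  have e : ∫ s in B, ∫ y, f (s0, y) ∂μ = (∫ y, f (s0, y) ∂μ) * volume.real B := by
    rw [setIntegral_const, smul_eq_mul, mul_comm]
  rw [e] at a2
  rw [Real.dist_eq] at hT
  rw [abs_le] at a1 a2 ⊢
  rw [abs_lt] at hT
  constructor <;> linarith

lemma goodS_union (x : ℝ → ℝ × ℝ → X) (hx : ∀ T, Continuous (x T))
  (hK : ∀ F : X → ℝ, Continuous F → HasCompactSupport F → ∀ B : Set (ℝ × ℝ), MeasurableSet B →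
    volume B < ∞ → Tendsto (fun T => ∫ s in B, F (x T s)) atTop
      (𝓝 ((∫ y, F y ∂μ) * volume.real B)))
    (f : (ℝ × ℝ) × X → ℝ) (hf : Continuous f) (C : ℝ) (hC : ∀ p, |f p| ≤ C)
    (ε : ℝ) (S1 S2 : Set (ℝ × ℝ)) (h1 : goodS μ x f ε S1) (h2 : goodS μ x f ε S2) :
    goodS μ x f ε (S1 ∪ S2) := by
  obtain ⟨A1, hA1, hs1, hg1⟩ := h1
  obtain ⟨A2, hA2, hs2, hg2⟩ := h2
  refine ⟨A1 ∪ A2, hA1.union hA2, Set.union_subset_union hs1 hs2, fun B hBS hB hBf δ hδ => ?_⟩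
  have f1 : volume (B ∩ A1) < ∞ := (measure_mono Set.inter_subset_left).trans_lt hBf
  have f2 : volume (B \ A1) < ∞ := (measure_mono Set.sdiff_subset).trans_lt hBf
  filter_upwards [hg1 (B ∩ A1) Set.inter_subset_right (hB.inter hA1) f1 (δ / 2) (by positivity),
    hg2 (B \ A1) (fun s hs => (hBS hs.1).resolve_left hs.2) (hB.diff hA1) f2 (δ / 2) (by positivity)]
    with T t1 t2
  have i1 := intOn_of_bdd (fun s => f (s, x T s)) (hf.comp (continuous_id.prodMk (hx T))) C
    (fun s => hC _) B hBf
  have i3 := intOn_of_bdd _ (cont_fib μ f hf C hC) C (fib_bound μ f C hC) B hBf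
  rw [← integral_inter_add_sdiff hA1 i1, ← integral_inter_add_sdiff hA1 i3,
    ← measureReal_inter_add_sdiff (s := B) hA1 hBf.ne]
  rw [abs_le] at t1 t2 ⊢
  constructor <;> linarith

lemma equi_cs (x : ℝ → ℝ × ℝ → X) (hx : ∀ T, Continuous (x T))
  (hK : ∀ F : X → ℝ, Continuous F → HasCompactSupport F → ∀ B : Set (ℝ × ℝ), MeasurableSet B →
    volume B < ∞ → Tendsto (fun T => ∫ s in B, F (x T s)) atTop
      (𝓝 ((∫ y, F y ∂μ) * volume.real B)))
    (f : (ℝ × ℝ) × X → ℝ) (hf : Continuous f) (C : ℝ) (hC : ∀ p, |f p| ≤ C)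
    (L : Set X) (hL : IsCompact L) (hfL : ∀ s, ∀ y ∉ L, f (s, y) = 0)
    (Q : Set (ℝ × ℝ)) (hQ : IsCompact Q) :
    Tendsto (fun T => ∫ s in Q, f (s, x T s)) atTop (𝓝 (∫ s in Q, ∫ y, f (s, y) ∂μ)) := by
  rw [Metric.tendsto_nhds]
  intro δ hδ
  have hb0 : 0 ≤ volume.real Q := measureReal_nonneg
  set ε := δ / (4 * (volume.real Q + 1)) with hε
  have hε0 : 0 < ε := by positivity
  have hg : goodS μ x f ε Q := by
    refine hQ.induction_on (p := goodS μ x f ε) ?_ ?_ ?_ ?_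
    · refine ⟨∅, MeasurableSet.empty, subset_rfl, fun B hB _ _ δ hδ => ?_⟩
      rw [Set.subset_empty_iff.1 hB]
      exact Eventually.of_forall fun T => by simpa using hδ.le
    · rintro s t hst ⟨S', h1, h2, h3⟩
      exact ⟨S', h1, hst.trans h2, h3⟩
    · exact fun s t hs ht => goodS_union μ x hx hK f hf C hC ε s t hs ht
    · intro s _
      obtain ⟨S, hS, hg⟩ := goodS_local μ x hx hK f hf C hC L hL hfL ε hε0 s
      exact ⟨S, mem_nhdsWithin_of_mem_nhds hS, hg⟩
  obtain ⟨S', h1, h2, h3⟩ := hg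
  filter_upwards [h3 Q h2 hQ.measurableSet hQ.measure_lt_top (δ / 4) (by positivity)] with T hT
  rw [Real.dist_eq]
  have : 2 * ε * volume.real Q ≤ δ / 2 := by
    have : 2 * ε * volume.real Q ≤ 2 * ε * (volume.real Q + 1) := by gcongr; linarith
    refine this.trans (le_of_eq ?_)
    rw [hε]; field_simp; ring
  linarith

lemma equi_bdd (x : ℝ → ℝ × ℝ → X) (hx : ∀ T, Continuous (x T))
  (hK : ∀ F : X → ℝ, Continuous F → HasCompactSupport F → ∀ B : Set (ℝ × ℝ), MeasurableSet B →
    volume B < ∞ → Tendsto (fun T => ∫ s in B, F (x T s)) atTop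
      (𝓝 ((∫ y, F y ∂μ) * volume.real B)))
    (f : (ℝ × ℝ) × X → ℝ) (hf : Continuous f) (C : ℝ) (hC : ∀ p, |f p| ≤ C)
    (Q : Set (ℝ × ℝ)) (hQ : IsCompact Q) :
    Tendsto (fun T => ∫ s in Q, f (s, x T s)) atTop (𝓝 (∫ s in Q, ∫ y, f (s, y) ∂μ)) := by
  have hC0 : 0 ≤ C := by
    obtain ⟨y, -⟩ := exists_pt_of_ae μ (p := fun _ => True) (by simp)
    exact (abs_nonneg _).trans (hC ((0, 0), y))
  rw [Metric.tendsto_nhds]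
  intro δ hδ
  have hb0 : 0 ≤ volume.real Q := measureReal_nonneg
  have hQf : volume Q < ∞ := hQ.measure_lt_top
  set q := volume.real Q with hq
  set η := δ / (6 * ((C + 1) * (q + 1))) with hη
  have hη0 : 0 < η := by positivity
  obtain ⟨χ, hχc, hχs, hχ0, hχ1, hχi⟩ := exists_cutoff μ η hη0
  set g : (ℝ × ℝ) × X → ℝ := fun p => f p * χ p.2 with hgdef
  have hg : Continuous g := hf.mul (hχc.comp continuous_snd)
  have hgC : ∀ p, |g p| ≤ C := by
    intro p
    rw [hgdef, abs_mul, abs_of_nonneg (hχ0 _)]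
    exact (mul_le_of_le_one_right (abs_nonneg _) (hχ1 _)).trans (hC p)
  have hfg : ∀ p, |f p - g p| ≤ C * (1 - χ p.2) := by
    intro p
    have : f p - g p = f p * (1 - χ p.2) := by simp only [hgdef]; ring
    rw [this, abs_mul, abs_of_nonneg (sub_nonneg.2 (hχ1 _))]
    exact mul_le_mul_of_nonneg_right (hC p) (sub_nonneg.2 (hχ1 _))
  have t1 := equi_cs μ x hx hK g hg C hgC (tsupport χ) hχs.isCompact
    (fun s y hy => by simp [hgdef, image_eq_zero_of_notMem_tsupport hy]) Q hQ
  have t2 := hK χ hχc hχs Q hQ.measurableSet hQf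
  have hsm : C * (η * q) ≤ δ / 6 := by
    have : C * (η * q) ≤ (C + 1) * (η * (q + 1)) := by gcongr <;> linarith
    refine this.trans (le_of_eq ?_)
    rw [hη]; field_simp
  have hsm2 : C * η ≤ δ / 6 := by
    have : C * η ≤ (C + 1) * (η * (q + 1)) := by
      refine mul_le_mul (by linarith) (by nlinarith) hη0.le (by linarith)
    refine this.trans (le_of_eq ?_)
    rw [hη]; field_simp
  have hχint : Integrable χ μ := Integrable.of_bound (C := 1) hχc.aestronglyMeasurable
    (Eventually.of_forall fun y => by rw [Real.norm_eq_abs, abs_of_nonneg (hχ0 _)]; exact hχ1 _)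
  filter_upwards [Metric.tendsto_nhds.1 t1 (δ / 6) (by positivity),
    Metric.tendsto_nhds.1 t2 η hη0] with T b1 b2
  rw [Real.dist_eq] at b1 b2 ⊢
  have i1 := intOn_of_bdd (fun s => f (s, x T s)) (hf.comp (continuous_id.prodMk (hx T))) C
    (fun s => hC _) Q hQf
  have i2 := intOn_of_bdd (fun s => g (s, x T s)) (hg.comp (continuous_id.prodMk (hx T))) C
    (fun s => hgC _) Q hQf
  have i3 := intOn_of_bdd _ (cont_fib μ f hf C hC) C (fib_bound μ f C hC) Q hQf
  have i4 := intOn_of_bdd _ (cont_fib μ g hg C hgC) C (fib_bound μ g C hgC) Q hQf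
  have i5 := intOn_of_bdd (fun s => χ (x T s)) (hχc.comp (hx T)) 1
    (fun s => by rw [abs_of_nonneg (hχ0 _)]; exact hχ1 _) Q hQf
  have i6 := intOn_of_bdd (fun _ => (1 : ℝ)) continuous_const 1 (by simp) Q hQf
  have a1 : |(∫ s in Q, f (s, x T s)) - ∫ s in Q, g (s, x T s)| ≤
      C * (q - ∫ s in Q, χ (x T s)) := by
    rw [← integral_sub i1 i2]
    have e : C * (q - ∫ s in Q, χ (x T s)) = ∫ s in Q, C * (1 - χ (x T s)) := by
      rw [integral_const_mul, integral_sub i6 i5, setIntegral_const]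
      simp [hq]
    rw [e]
    refine (abs_integral_le_integral_abs).trans ?_
    refine integral_mono (i1.sub i2).abs ((i6.sub i5).const_mul C) ?_
    intro s
    exact hfg _
  have a2 : |(∫ s in Q, ∫ y, f (s, y) ∂μ) - ∫ s in Q, ∫ y, g (s, y) ∂μ| ≤ C * η * q := by
    rw [← integral_sub i3 i4, ← Real.norm_eq_abs]
    refine norm_setIntegral_le_of_norm_le_const hQf (fun s _ => ?_)
    have j1 : Integrable (fun y => f (s, y)) μ :=
      Integrable.of_bound (C := C) (hf.comp (by fun_prop)).aestronglyMeasurable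
        (Eventually.of_forall fun y => hC _)
    have j2 : Integrable (fun y => g (s, y)) μ :=
      Integrable.of_bound (C := C) (hg.comp (by fun_prop)).aestronglyMeasurable
        (Eventually.of_forall fun y => hgC _)
    rw [← integral_sub j1 j2, Real.norm_eq_abs]
    refine (abs_integral_le_integral_abs).trans ?_
    have : ∫ y, C * (1 - χ y) ∂μ ≤ C * η := by
      rw [integral_const_mul, integral_sub (integrable_const 1) hχint]
      simp
      exact mul_le_mul_of_nonneg_left (by linarith) hC0
    refine le_trans ?_ this
    refine integral_mono (j1.sub j2).abs (((integrable_const 1).sub hχint).const_mul C) ?_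
    intro y
    exact hfg _
  have a3 : C * (q - ∫ s in Q, χ (x T s)) ≤ δ / 3 := by
    have : q - ∫ s in Q, χ (x T s) ≤ η * q + η := by
      rw [abs_lt] at b2
      have : (1 - η) * q ≤ (∫ y, χ y ∂μ) * q := mul_le_mul_of_nonneg_right hχi hb0
      linarith
    have := mul_le_mul_of_nonneg_left this hC0
    linarith
  rw [abs_le] at a1 a2
  rw [abs_lt] at b1 ⊢
  constructor <;> linarith
end
end

open scoped ENNReal
section
set_option linter.unusedSectionVars false

lemma exp_null (v : Fin 3 → ℝ) (hv : ∀ j, v j ≠ 0) (A : Set (Fin 3 → ℝ)) (hA : volume A = 0) :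
    volume {y : Fin 3 → ℝ | (fun j => v j * Real.exp (y j)) ∈ A} = 0 := by
  have h1 : volume (A ∩ {y | ∀ j, y j ≠ 0}) = 0 := measure_mono_null Set.inter_subset_left hA
  have hd : DifferentiableOn ℝ (fun y : Fin 3 → ℝ => fun j => Real.log (y j / v j))
      (A ∩ {y | ∀ j, y j ≠ 0}) := by
    rw [differentiableOn_pi]
    intro j y hy
    have : y j / v j ≠ 0 := div_ne_zero (hy.2 j) (hv j)
    refine DifferentiableAt.differentiableWithinAt ?_
    refine DifferentiableAt.log ?_ this
    fun_prop
  refine measure_mono_null ?_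
    (MeasureTheory.addHaar_image_eq_zero_of_differentiableOn_of_addHaar_eq_zero volume hd h1)
  intro y hy
  refine ⟨fun j => v j * Real.exp (y j), ⟨hy, fun j => mul_ne_zero (hv j) (Real.exp_pos _).ne'⟩, ?_⟩
  funext j
  simp only
  rw [mul_div_cancel_left₀ _ (hv j), Real.log_exp]

/-- the linear map of exponents -/
def linL (l1 l2 : Fin 3 → ℝ) : ((ℝ × ℝ) × ℝ) →ₗ[ℝ] (Fin 3 → ℝ) where
  toFun q := fun j => q.2 + (q.1.1 * l1 j + q.1.2 * l2 j)
  map_add' p q := by funext j; simp; ring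
  map_smul' c q := by funext j; simp; ring

lemma linL_inj (l1 l2 : Fin 3 → ℝ) (h1 : ∑ j, l1 j = 0) (h2 : ∑ j, l2 j = 0)
    (hind : LinearIndependent ℝ ![l1, l2]) : Function.Injective (linL l1 l2) := by
  rw [injective_iff_map_eq_zero]
  rintro ⟨⟨s1, s2⟩, τ⟩ h
  have hj : ∀ j, τ + (s1 * l1 j + s2 * l2 j) = 0 := fun j => congrFun h j
  have hτ : τ = 0 := by
    rw [Fin.sum_univ_three] at h1 h2
    have a := hj 0
    have b := hj 1
    have c := hj 2
    linear_combination (1/3) * (a + b + c) - s1 / 3 * h1 - s2 / 3 * h2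
  have := LinearIndependent.pair_iff.1 hind s1 s2 (by
    funext j
    have := hj j
    rw [hτ] at this
    simpa using this)
  rw [this.1, this.2, hτ]
  rfl

lemma linL_null (l1 l2 : Fin 3 → ℝ) (h1 : ∑ j, l1 j = 0) (h2 : ∑ j, l2 j = 0)
    (hind : LinearIndependent ℝ ![l1, l2]) (A : Set (Fin 3 → ℝ)) (hA : volume A = 0) :
    volume (linL l1 l2 ⁻¹' A) = 0 := by
  have hfr : Module.finrank ℝ ((ℝ × ℝ) × ℝ) = Module.finrank ℝ (Fin 3 → ℝ) := by
    simp
  let e := (LinearMap.linearEquivOfInjective (linL l1 l2) (linL_inj l1 l2 h1 h2 hind)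
    hfr).toContinuousLinearEquiv
  have hV2 : (volume : Measure (ℝ × ℝ)).IsAddHaarMeasure :=
    Measure.prod.instIsAddHaarMeasure (volume : Measure ℝ) (volume : Measure ℝ)
  have hV : (volume : Measure ((ℝ × ℝ) × ℝ)).IsAddHaarMeasure :=
    Measure.prod.instIsAddHaarMeasure (volume : Measure (ℝ × ℝ)) (volume : Measure ℝ)
  have hH : (Measure.map e (volume : Measure ((ℝ × ℝ) × ℝ))).IsAddHaarMeasure :=
    e.isAddHaarMeasure_map _
  have hac : Measure.map e (volume : Measure ((ℝ × ℝ) × ℝ)) ≪ (volume : Measure (Fin 3 → ℝ)) :=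
    Measure.absolutelyContinuous_isAddHaarMeasure _ _
  have h3 := hac hA
  exact Measure.preimage_null_of_map_null e.continuous.measurable.aemeasurable h3

lemma QN_of (h : ℝ × ℝ → SL3R) (v l1 l2 : Fin 3 → ℝ) (hv : ∀ j, v j ≠ 0)
    (h1 : ∑ j, l1 j = 0) (h2 : ∑ j, l2 j = 0) (hind : LinearIndependent ℝ ![l1, l2])
    (hh : ∀ s, (h s).1 *ᵥ ![1,0,0] = fun j => v j * Real.exp (s.1 * l1 j + s.2 * l2 j)) : QN h := by
  intro A _ h0
  refine measure_mono_null ?_ (linL_null l1 l2 h1 h2 hind _ (exp_null v hv A h0))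
  intro q hq
  simp only [Set.mem_ofPred_eq, hh] at hq
  show (fun j => v j * Real.exp (linL l1 l2 q j)) ∈ A
  convert hq using 1
  funext j
  simp only [linL, LinearMap.coe_mk, AddHom.coe_mk, Pi.smul_apply, smul_eq_mul, Real.exp_add]
  ring
end

/-- **Equidistribution of expanding translates of the compact pieces of the closed
`A`-orbits** (Corollary `expandingflats`): with `K = ℚ(α)` a totally real cubic field
whose ring of integers is `ℤ[α]`, `g₀` the rescaled basis matrix of `{α², α, 1}`,
`g_I` the rescaled basis matrix of a fractional ideal `I`, and `ε₁, ε₂` totally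
positive units with linearly independent logarithm vectors, the translates
`Γ g_I â(s) g₀⁻¹ a(-T)`, `s ∈ [0,1]²`, of the piece `{Γ g_I â(s)}` of the closed
`A`-orbit through `Γ g_I` equidistribute in `Γ \ G` as `T → ∞`. -/
theorem expanding_flats_equidistribution
    (K : Type*) [Field K] [NumberField K]
    (a₁ a₂ a₃ : ℤ)
    (hirr : Irreducible (X ^ 3 + C (a₁ : ℚ) * X ^ 2 + C (a₂ : ℚ) * X + C (a₃ : ℚ)))
    (hrank : Module.finrank ℚ K = 3)
    (α : K) (hα : α ^ 3 + (a₁ : K) * α ^ 2 + (a₂ : K) * α + (a₃ : K) = 0)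
    -- `ℤ[α]` is the ring of integers of `K`
    (hmax : Algebra.adjoin ℤ ({α} : Set K) = integralClosure ℤ K)
    -- the three (distinct) real embeddings of `K`
    (σ : Fin 3 → (K →+* ℝ)) (hσ : Function.Injective σ)
    -- `g₀`: the rescaled basis matrix of the basis `{α², α, 1}` of `ℤ[α]`
    (d₀ : ℝ)
    (hd₀ : d₀ = Matrix.det (Matrix.of ![fun j => σ j α ^ 2, fun j => σ j α, fun _ => (1:ℝ)]))
    (hd₀pos : 0 < d₀)
    (g₀ : SL3R)
    (hg₀ : (g₀ : Matrix (Fin 3) (Fin 3) ℝ) =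
      d₀ ^ (-(1/3) : ℝ) • Matrix.of ![fun j => σ j α ^ 2, fun j => σ j α, fun _ => (1:ℝ)])
    -- a fractional ideal `I` with `ℤ`-basis `b` and rescaled basis matrix `g_I`
    (I : FractionalIdeal (nonZeroDivisors (𝓞 K)) K)
    (b : Fin 3 → K)
    (hb : Submodule.span ℤ (Set.range b) =
      Submodule.restrictScalars ℤ (I : Submodule (𝓞 K) K))
    (dI : ℝ) (hdI : dI = Matrix.det (Matrix.of fun i j => σ j (b i))) (hdIpos : 0 < dI)
    (gI : SL3R)
    (hgI : (gI : Matrix (Fin 3) (Fin 3) ℝ) = dI ^ (-(1/3) : ℝ) • Matrix.of fun i j => σ j (b i))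
    -- totally positive units `ε₁, ε₂` with linearly independent logarithm vectors
    (ε₁ ε₂ : K)
    (hε₁ : ∃ u : (𝓞 K)ˣ, ((u : 𝓞 K) : K) = ε₁)
    (hε₂ : ∃ u : (𝓞 K)ˣ, ((u : 𝓞 K) : K) = ε₂)
    (hε₁pos : ∀ j, 0 < σ j ε₁) (hε₂pos : ∀ j, 0 < σ j ε₂)
    (hindep : LinearIndependent ℝ
      ![(fun i => Real.log (σ i ε₁) : Fin 3 → ℝ), (fun i => Real.log (σ i ε₂) : Fin 3 → ℝ)])
    -- `â(s₁, s₂) = diag(σⱼ(ε₁)^{s₁} σⱼ(ε₂)^{s₂})ⱼ`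
    (ahat : ℝ → ℝ → SL3R)
    (hahat : ∀ s₁ s₂ : ℝ, (ahat s₁ s₂ : Matrix (Fin 3) (Fin 3) ℝ) =
      Matrix.diagonal (fun j => σ j ε₁ ^ s₁ * σ j ε₂ ^ s₂))
    -- `μ`: the normalized Haar (right-invariant Borel probability) measure on `Γ \ G`
    (μ : Measure X3) [IsProbabilityMeasure μ]
    (hμinv : ∀ g : SL3R, Measure.map (rmul3 g) μ = μ)
    -- `f`: a bounded continuous function on `𝕋² × Γ\G`
    (f : (ℝ × ℝ) × X3 → ℝ)
    (hf_cont : Continuous f)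
    (hf_bdd : ∃ C : ℝ, ∀ p, |f p| ≤ C)
    (hf_per : ∀ (s : ℝ × ℝ) (k : ℤ × ℤ) (y : X3),
      f ((s.1 + (k.1 : ℝ), s.2 + (k.2 : ℝ)), y) = f (s, y)) :
    Tendsto
      (fun T : ℝ =>
        ∫ s in (Set.Icc (0:ℝ) 1) ×ˢ (Set.Icc (0:ℝ) 1),
          f (s, proj3 (gI * ahat s.1 s.2 * g₀⁻¹ * amat (-T))))
      atTop
      (𝓝 (∫ s in (Set.Icc (0:ℝ) 1) ×ˢ (Set.Icc (0:ℝ) 1), ∫ y, f (s, y) ∂μ)) := by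
  have := X3.smulInvariant μ hμinv
  obtain ⟨C, hC⟩ := hf_bdd
  -- the column `v`
  set v : Fin 3 → ℝ := (g₀⁻¹).1 *ᵥ ![1, 0, 0] with hv
  have hgv : g₀.1 *ᵥ v = ![1, 0, 0] := by
    rw [hv, Matrix.mulVec_mulVec]
    have : g₀.1 * (g₀⁻¹).1 = 1 := by
      rw [← Matrix.SpecialLinearGroup.coe_mul, mul_inv_cancel]; rfl
    rw [this, Matrix.one_mulVec]
  have hc0 : d₀ ^ (-(1/3) : ℝ) ≠ 0 := (Real.rpow_pos_of_pos hd₀pos _).ne'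
  erw [hg₀] at hgv
  have r0 := congrFun hgv 0
  have r1 := congrFun hgv 1
  have r2 := congrFun hgv 2
  rw [Matrix.smul_mulVec] at r0 r1 r2
  simp [Matrix.mulVec, dotProduct, Fin.sum_univ_three] at r0 r1 r2
  have hc0' : d₀ ^ (-(3 : ℝ)⁻¹) ≠ 0 := (Real.rpow_pos_of_pos hd₀pos _).ne'
  have q1 := r1.resolve_left hc0'
  have q2 := r2.resolve_left hc0'
  have hdet : d₀ = (σ 0 α - σ 1 α) * (σ 0 α - σ 2 α) * (σ 1 α - σ 2 α) := by
    rw [hd₀, Matrix.det_fin_three]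
    simp
    ring
  have h01 : σ 0 α - σ 1 α ≠ 0 := fun h => by rw [h] at hdet; simp at hdet; exact hd₀pos.ne' hdet
  have h02 : σ 0 α - σ 2 α ≠ 0 := fun h => by rw [h] at hdet; simp at hdet; exact hd₀pos.ne' hdet
  have h12 : σ 1 α - σ 2 α ≠ 0 := fun h => by rw [h] at hdet; simp at hdet; exact hd₀pos.ne' hdet
  have hvj : ∀ j, v j ≠ 0 := by
    intro j hj
    have hall : v 0 = 0 ∧ v 1 = 0 ∧ v 2 = 0 := by
      fin_cases j
      · have hj' : v 0 = 0 := hj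
        have e1 : v 1 = 0 := by
          have : (σ 1 α - σ 2 α) * v 1 = 0 := by
            linear_combination q1 - σ 2 α * q2 - (σ 0 α - σ 2 α) * hj'
          exact (mul_eq_zero.1 this).resolve_left h12
        exact ⟨hj', e1, by linear_combination q2 - hj' - e1⟩
      · have hj' : v 1 = 0 := hj
        have e1 : v 0 = 0 := by
          have : (σ 0 α - σ 2 α) * v 0 = 0 := by
            linear_combination q1 - σ 2 α * q2 - (σ 1 α - σ 2 α) * hj'
          exact (mul_eq_zero.1 this).resolve_left h02
        exact ⟨e1, hj', by linear_combination q2 - hj' - e1⟩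
      · have hj' : v 2 = 0 := hj
        have e1 : v 0 = 0 := by
          have : (σ 0 α - σ 1 α) * v 0 = 0 := by
            linear_combination q1 - σ 1 α * q2 - (σ 2 α - σ 1 α) * hj'
          exact (mul_eq_zero.1 this).resolve_left h01
        exact ⟨e1, by linear_combination q2 - hj' - e1, hj'⟩
    obtain ⟨z0, z1, z2⟩ := hall
    rw [z0, z1, z2] at r0
    simp at r0
  -- the logarithms sum to zero
  have hsum1 : ∑ j, Real.log (σ j ε₁) = 0 := by
    have h := (ahat 1 0).2
    erw [hahat] at h
    rw [Matrix.det_diagonal] at h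
    simp at h
    rw [← Real.log_prod (fun j _ => (hε₁pos j).ne')]
    have h' : ∏ j, σ j ε₁ = 1 := by simpa using h
    rw [h', Real.log_one]
  have hsum2 : ∑ j, Real.log (σ j ε₂) = 0 := by
    have h := (ahat 0 1).2
    erw [hahat] at h
    rw [Matrix.det_diagonal] at h
    simp at h
    rw [← Real.log_prod (fun j _ => (hε₂pos j).ne')]
    have h' : ∏ j, σ j ε₂ = 1 := by simpa using h
    rw [h', Real.log_one]
  have hexp : ∀ (s : ℝ × ℝ) j, σ j ε₁ ^ s.1 * σ j ε₂ ^ s.2 =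
      Real.exp (s.1 * Real.log (σ j ε₁) + s.2 * Real.log (σ j ε₂)) := by
    intro s j
    rw [Real.rpow_def_of_pos (hε₁pos j), Real.rpow_def_of_pos (hε₂pos j), ← Real.exp_add]
    ring_nf
  set h : ℝ × ℝ → SL3R := fun s => ahat s.1 s.2 * g₀⁻¹ with hh
  have hcont : Continuous h := by
    have : Continuous fun s : ℝ × ℝ => ahat s.1 s.2 := by
      rw [SL3R.continuous_iff]
      have e : (fun s : ℝ × ℝ => (ahat s.1 s.2).1) = fun s => Matrix.diagonal
          (fun j => Real.exp (s.1 * Real.log (σ j ε₁) + s.2 * Real.log (σ j ε₂))) := by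
        funext s
        refine (hahat s.1 s.2).trans ?_
        simp_rw [hexp]
      rw [e]
      exact Continuous.matrix_diagonal (by fun_prop)
    exact this.mul continuous_const
  have hQN : QN h := by
    refine QN_of h v _ _ hvj hsum1 hsum2 hindep fun s => ?_
    have e : (h s).1 = Matrix.diagonal (fun j => σ j ε₁ ^ s.1 * σ j ε₂ ^ s.2) * (g₀⁻¹).1 := by
      rw [← hahat]; rfl
    rw [e, ← Matrix.mulVec_mulVec, ← hv]
    funext j
    rw [Matrix.mulVec_diagonal, hexp]
    ring
  have hpt : ∀ (T : ℝ) (s : ℝ × ℝ), proj3 (gI * ahat s.1 s.2 * g₀⁻¹ * amat (-T)) =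
      amat T • (h s)⁻¹ • proj3 gI := by
    intro T s
    rw [X3.smul_proj3, X3.smul_proj3, amat_neg, inv_inv, hh]
    simp only [mul_assoc]
  simp_rw [hpt]
  have hcs : Continuous fun s => (h s)⁻¹ • proj3 gI :=
    Continuous.smul (f := fun s => (h s)⁻¹) (g := fun _ => proj3 gI) hcont.inv continuous_const
  exact equi_bdd μ (fun T s => amat T • (h s)⁻¹ • proj3 gI)
    (fun T => (continuous_const_smul (amat T)).comp hcs)
    (fun F hF hFc B hB hBf => equi_K μ h hcont hQN (proj3 gI) F hF hFc B hB hBf)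
    f hf_cont C hC _ (isCompact_Icc.prod isCompact_Icc)
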